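/- arXiv:1502.07674 — 3 statements merged into one kernel-verified Lean document; each statement's English description precedes it below -/
import Mathlib

section
/- For all n ≥ 1 and k ≥ 1, the unsigned Stirling numbers of the first kind satisfy (n + 1 - k) · C(n+1, k) = Σ_{i ≥ 1} binomial(k + 2i, k - 1) · C(n+1, k + 2i) + binomial(n+1, 2) · C(n, k). -/
/-- Number of cycles (orbits, including fixed points) of a permutation. -/
def cycleCount {α : Type*} [Fintype α] [DecidableEq α] (σ : Equiv.Perm α) : ℕ :=
  Fintype.card α - σ.cycleType.sum + σ.cycleType.card

/-- Unsigned Stirling number of the first kind: the number of permutations of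
`[n]` with exactly `k` cycles. -/
def stirling1 (n k : ℕ) : ℕ :=
  (Finset.univ.filter (fun σ : Equiv.Perm (Fin n) => cycleCount σ = k)).card

open Equiv Equiv.Perm Polynomial

theorem cycleCount_eq {α : Type*} [Fintype α] [DecidableEq α] {σ : Perm α} {k : ℕ} :
    cycleCount σ = k ↔ Fintype.card α + σ.cycleType.card = k + σ.cycleType.sum := by
  have := σ.sum_cycleType_le
  unfold cycleCount
  omega

theorem cycleCount_extendDomain {α β : Type*} [Fintype α] [DecidableEq α] [Fintype β]
    [DecidableEq β] {p : β → Prop} [DecidablePred p] (f : α ≃ Subtype p) (σ : Perm α) :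
    cycleCount (σ.extendDomain f) + Fintype.card α = cycleCount σ + Fintype.card β := by
  have h : Fintype.card α ≤ Fintype.card β :=
    (Fintype.card_congr f).le.trans (Fintype.card_subtype_le p)
  have := σ.sum_cycleType_le
  simp only [cycleCount, cycleType_extendDomain]
  omega

theorem cycleCount_permCongr {α β : Type*} [Fintype α] [DecidableEq α] [Fintype β]
    [DecidableEq β] (e : α ≃ β) (σ : Perm α) :
    cycleCount (e.permCongr σ) = cycleCount σ := by
  let f : α ≃ Subtype (fun _ : β => True) := e.trans (Equiv.Set.univ β).symm
  have h : e.permCongr σ = σ.extendDomain f := by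
    ext x
    exact (Perm.extendDomain_apply_subtype σ f (b := x) trivial).symm
  have := cycleCount_extendDomain f σ
  rw [← h, Fintype.card_congr e] at this
  omega

theorem cycleCount_optionCongr {α : Type*} [Fintype α] [DecidableEq α] (σ : Perm α) :
    cycleCount σ.optionCongr = cycleCount σ + 1 := by
  let f : α ≃ Subtype (fun x : Option α => x.isSome) := (optionIsSomeEquiv α).symm
  have h : σ.optionCongr = σ.extendDomain f := by
    ext1 x
    cases x with
    | none => rw [Perm.extendDomain_apply_not_subtype σ f (by simp)]; simp
    | some a => exact (Perm.extendDomain_apply_image σ f a).symm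
  have := cycleCount_extendDomain f σ
  rw [← h, Fintype.card_option] at this
  omega

/-- Multiplying by a transposition that joins a fixed point to another point merges two cycles. -/
theorem cycleCount_swap_mul {α : Type*} [Fintype α] [DecidableEq α] {σ : Perm α} {a b : α}
    (hab : a ≠ b) (ha : σ a = a) : cycleCount (swap a b * σ) + 1 = cycleCount σ := by
  suffices h : (swap a b * σ).cycleType.sum + σ.cycleType.card =
      (swap a b * σ).cycleType.card + σ.cycleType.sum + 1 by
    have := σ.sum_cycleType_le
    have := (swap a b * σ).sum_cycleType_le
    unfold cycleCount
    omega
  by_cases hb : σ b = b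
  · have hd : Perm.Disjoint (swap a b) σ := by
      intro x
      by_cases hxa : x = a
      · exact .inr (hxa ▸ ha)
      by_cases hxb : x = b
      · exact .inr (hxb ▸ hb)
      exact .inl (swap_apply_of_ne_of_ne hxa hxb)
    rw [hd.cycleType_mul, (isCycle_swap hab).cycleType, card_support_swap hab]
    simp
    omega
  · obtain ⟨τ, hτ⟩ : ∃ τ, τ = σ * (σ.cycleOf b)⁻¹ := ⟨_, rfl⟩
    have hd : Perm.Disjoint (σ.cycleOf b) τ := by
      rw [hτ]
      exact (disjoint_mul_inv_of_mem_cycleFactorsFinset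
        (cycleOf_mem_cycleFactorsFinset_iff.2 (mem_support.2 hb))).symm
    have hσ : σ = σ.cycleOf b * τ := by rw [hd.commute.eq, hτ]; simp
    have hc : (σ.cycleOf b).IsCycle := isCycle_cycleOf σ hb
    have hca : σ.cycleOf b a = a := by
      by_contra h
      have := (mem_support_cycleOf_iff.1 (mem_support.2 h)).1
      exact hab (this.symm.eq_of_left ha)
    have hcb : σ.cycleOf b b ≠ b := by simpa using hb
    have hτa : τ a = a := by
      have := congrArg (· a) hσ
      simp only [ha, Perm.coe_mul, Function.comp_apply] at this
      exact (σ.cycleOf b).injective (this.symm.trans hca.symm)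
    have hτb : τ b = b := (hd b).resolve_left hcb
    have hl : σ.toList b ≠ [] := by simpa using hb
    obtain ⟨y, l, hyl⟩ := List.exists_cons_of_ne_nil hl
    have hy : y = b := by
      have := toList_getElem_zero (p := σ) (x := b) (mem_support.2 hb)
      simpa [hyl] using this
    subst hy
    have hnd : (a :: y :: l).Nodup := by
      rw [List.nodup_cons, ← hyl]
      refine ⟨fun h => ?_, nodup_toList σ y⟩
      exact hab ((mem_toList_iff.1 h).1.symm.eq_of_left ha)
    have hs : swap a y * σ.cycleOf y = (a :: y :: l).formPerm := by
      rw [List.formPerm_cons_cons, ← hyl, formPerm_toList]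
    have hs' : (swap a y * σ.cycleOf y).IsCycle := by
      rw [hs]
      exact List.isCycle_formPerm hnd (by simp)
    have hcard : (swap a y * σ.cycleOf y).support.card = (σ.cycleOf y).support.card + 1 := by
      rw [hs, List.support_formPerm_of_nodup _ hnd (by simp), List.toFinset_card_of_nodup hnd,
        ← length_toList, hyl]
      rfl
    have hd' : Perm.Disjoint (swap a y * σ.cycleOf y) τ := by
      intro x
      by_cases hxa : x = a
      · exact .inr (hxa ▸ hτa)
      by_cases hxy : x = y
      · exact .inr (hxy ▸ hτb)
      refine (hd x).imp_left fun h => ?_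
      rw [Perm.mul_apply, h, swap_apply_of_ne_of_ne hxa hxy]
    have h1 : σ.cycleType = {(σ.cycleOf y).support.card} + τ.cycleType := by
      rw [← hc.cycleType, ← hd.cycleType_mul, ← hσ]
    have h2 : (swap a y * σ).cycleType = {(σ.cycleOf y).support.card + 1} + τ.cycleType := by
      rw [← hcard, ← hs'.cycleType, ← hd'.cycleType_mul, mul_assoc, ← hσ]
    rw [h1, h2]
    simp
    omega

theorem stirling1_succ (n k : ℕ) :
    stirling1 (n + 1) k =
      n * stirling1 n k + (Finset.univ.filter fun σ : Perm (Fin n) => cycleCount σ + 1 = k).card := by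
  let e : Perm (Fin (n + 1)) ≃ Option (Fin n) × Perm (Fin n) :=
    (finSuccEquiv n).permCongr.trans decomposeOption
  have he (x) : cycleCount (e.symm x) = cycleCount (swap none x.1 * x.2.optionCongr) := by
    rw [← cycleCount_permCongr (finSuccEquiv n)]
    congr 1
    exact (finSuccEquiv n).permCongr.apply_symm_apply _
  have hsome (i : Fin n) (σ : Perm (Fin n)) :
      cycleCount (e.symm (some i, σ)) = cycleCount σ := by
    have := cycleCount_swap_mul (σ := σ.optionCongr) (a := none) (b := some i) (by simp) (by simp)
    rw [cycleCount_optionCongr] at this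
    rw [he]
    exact Nat.add_right_cancel this
  have hnone (σ : Perm (Fin n)) : cycleCount (e.symm (none, σ)) = cycleCount σ + 1 := by
    rw [he, ← cycleCount_optionCongr]
    simp [← Perm.one_def]
  simp only [stirling1, Finset.card_filter]
  rw [← e.symm.sum_comp, Fintype.sum_prod_type, Fintype.sum_option]
  simp only [hsome, hnone]
  simp [add_comm]

theorem stirling1_eq_stirlingFirst (n k : ℕ) : stirling1 n k = Nat.stirlingFirst n k := by
  induction n generalizing k with
  | zero =>
    cases k <;> simp [stirling1, cycleCount, Finset.filter_singleton]
  | succ n ih =>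
    rw [stirling1_succ]
    cases k with
    | zero =>
      cases n with
      | zero => simp
      | succ n => simp [ih]
    | succ k =>
      rw [Nat.stirlingFirst_succ_succ, ← ih, ← ih]
      simp [stirling1]

theorem coeff_ascPochhammer (n k : ℕ) :
    (ascPochhammer ℤ n).coeff k = Nat.stirlingFirst n k := by
  induction n generalizing k with
  | zero => cases k <;> simp [coeff_one]
  | succ n ih =>
    rw [ascPochhammer_succ_right, mul_add, coeff_add, ← C_eq_natCast, coeff_mul_C, ih]
    cases k with
    | zero => cases n <;> simp
    | succ k =>
      rw [coeff_mul_X, ih, Nat.stirlingFirst_succ_succ]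
      push_cast
      ring

theorem X_mul_taylor_ascPochhammer_sub (n : ℕ) :
    X * (taylor 1 (ascPochhammer ℤ (n + 1)) - taylor (-1) (ascPochhammer ℤ (n + 1))) =
      C (2 * (n + 1 : ℤ)) * (X * ascPochhammer ℤ n) +
        C ((n : ℤ) * (n + 1)) * ascPochhammer ℤ n := by
  have h1 : X * taylor 1 (ascPochhammer ℤ (n + 1)) =
      ascPochhammer ℤ n * (X + (n : ℤ[X])) * (X + ((n + 1 : ℕ) : ℤ[X])) := by
    rw [← ascPochhammer_succ_right, ← ascPochhammer_succ_right, ascPochhammer_succ_left ℤ (n + 1),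
      taylor_apply, C_1]
  have h2 : taylor (-1) (ascPochhammer ℤ (n + 1)) = (X - 1) * ascPochhammer ℤ n := by
    have h : (ascPochhammer ℤ n).comp (X + 1) = taylor 1 (ascPochhammer ℤ n) := by
      rw [taylor_apply, C_1]
    rw [ascPochhammer_succ_left, h, taylor_mul, taylor_taylor, taylor_X]
    simp [sub_eq_add_neg]
  rw [mul_sub, h1, h2]
  simp only [map_mul, map_add, map_natCast, map_ofNat, map_one]
  push_cast
  ring

theorem sum_range_two_mul {M : Type*} [AddCommMonoid M] (g : ℕ → M) (n : ℕ) :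
    ∑ i ∈ Finset.range (2 * n), g i = ∑ i ∈ Finset.range n, (g (2 * i) + g (2 * i + 1)) := by
  induction n with
  | zero => simp
  | succ n ih => rw [mul_add_one, Finset.sum_range_succ, Finset.sum_range_succ, ih,
      Finset.sum_range_succ, add_assoc]

theorem coeff_taylor_eq_sum {R : Type*} [CommSemiring R] (r : R) (p : R[X]) (j : ℕ) {N : ℕ}
    (h : p.natDegree < j + N) :
    (taylor r p).coeff j = ∑ i ∈ Finset.range N, (j + i).choose j * p.coeff (j + i) * r ^ i := by
  rw [taylor_coeff, hasseDeriv_apply, sum_over_range' _ (by simp) _ h, eval_finsetSum,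
    Finset.sum_range_add, Finset.sum_eq_zero, zero_add]
  · simp
  · intro i hi
    simp [Nat.choose_eq_zero_of_lt (Finset.mem_range.1 hi)]

theorem coeff_taylor_one_sub_taylor_neg_one {R : Type*} [CommRing R] (p : R[X]) (j : ℕ) {N : ℕ}
    (h : p.natDegree < j + 2 * N) :
    (taylor 1 p).coeff j - (taylor (-1) p).coeff j =
      2 * ∑ i ∈ Finset.range N, ((j + (2 * i + 1)).choose j * p.coeff (j + (2 * i + 1)) : R) := by
  rw [coeff_taylor_eq_sum _ _ _ h, coeff_taylor_eq_sum _ _ _ h, ← Finset.sum_sub_distrib,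
    sum_range_two_mul, Finset.mul_sum]
  refine Finset.sum_congr rfl fun i _ => ?_
  simp [pow_succ, pow_mul]
  ring

/-- For all `n ≥ 1`, `k ≥ 1`:
`(n + 1 - k)·C(n+1, k) = ∑_{i ≥ 1} C(k+2i, k-1)·C(n+1, k+2i) + C(n+1, 2)·C(n, k)`.
The sum over `i ≥ 1` is finite; all terms with `i > n` vanish, so it is taken
over `1 ≤ i ≤ n`. -/
theorem stirling1_recurrence (n k : ℕ) (hn : 1 ≤ n) (hk : 1 ≤ k) :
    (n + 1 - k) * stirling1 (n + 1) k =
      (∑ i ∈ Finset.Icc 1 n,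
        Nat.choose (k + 2 * i) (k - 1) * stirling1 (n + 1) (k + 2 * i)) +
      Nat.choose (n + 1) 2 * stirling1 n k := by
  obtain ⟨j, rfl⟩ := Nat.exists_eq_add_of_le' hk
  simp only [stirling1_eq_stirlingFirst, Nat.add_sub_cancel]
  have hodd := coeff_taylor_one_sub_taylor_neg_one (ascPochhammer ℤ (n + 1)) j (N := n + 1)
    (by rw [ascPochhammer_natDegree]; omega)
  have hcoeff := congrArg (coeff · (j + 1)) (X_mul_taylor_ascPochhammer_sub n)
  simp only [coeff_X_mul, coeff_sub, coeff_add, coeff_C_mul, hodd, coeff_ascPochhammer] at hcoeff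
  rw [Finset.sum_range_succ', Finset.range_eq_Ico,
    Finset.sum_Ico_add' (fun i => (((j + (2 * i + 1)).choose j : ℕ) : ℤ) *
      (Nat.stirlingFirst (n + 1) (j + (2 * i + 1)) : ℤ)) 0 n 1] at hcoeff
  have hIcc : Finset.Ico (0 + 1) (n + 1) = Finset.Icc 1 n := rfl
  have hsum : ∑ i ∈ Finset.Icc 1 n, (((j + (2 * i + 1)).choose j : ℕ) : ℤ) *
      (Nat.stirlingFirst (n + 1) (j + (2 * i + 1)) : ℤ) =
      ∑ i ∈ Finset.Icc 1 n, (((j + 1 + 2 * i).choose j : ℕ) : ℤ) *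
        (Nat.stirlingFirst (n + 1) (j + 1 + 2 * i) : ℤ) :=
    Finset.sum_congr rfl fun i _ => by rw [show j + (2 * i + 1) = j + 1 + 2 * i by ring]
  have hchoose : (((n + 1).choose 2 : ℕ) : ℤ) * 2 = (n + 1) * n := by
    rw [Nat.choose_two_right]
    exact_mod_cast Nat.div_mul_cancel (Nat.even_mul_pred_self (n + 1)).two_dvd
  have hsub : ((n + 1 - (j + 1) : ℕ) : ℤ) * Nat.stirlingFirst (n + 1) (j + 1) =
      ((n : ℤ) - j) * Nat.stirlingFirst (n + 1) (j + 1) := by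
    rcases le_or_gt j n with h | h
    · push_cast [Nat.add_sub_add_right, Nat.cast_sub h]
      rfl
    · rw [Nat.stirlingFirst_eq_zero_of_lt (by omega)]
      simp
  rw [hIcc, hsum] at hcoeff
  zify
  rw [hsub]
  simp only [mul_zero, zero_add, Nat.choose_succ_self_right,
    Nat.stirlingFirst_succ_succ n j] at hcoeff ⊢
  push_cast at hcoeff ⊢
  refine mul_left_cancel₀ (two_ne_zero (α := ℤ)) ?_
  linear_combination -hcoeff - (Nat.stirlingFirst n (j + 1) : ℤ) * hchoose
end

section
/- (Zagier–Stanley) For n, k ≥ 1 with n - k even, the number of n-cycles ω in S_n such that ω ∘ (1 2 ... n) has exactly k cycles equals 2·C(n+1, k) / (n(n+1)), where C(n+1, k) is the unsigned Stirling number of the first kind. -/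
/-- `xi n k`: the number of `n`-cycles `ω` such that `ω ∘ (1 2 ⋯ n)` has
exactly `k` cycles. -/
noncomputable def xi (n k : ℕ) : ℕ :=
  {ω : Equiv.Perm (Fin n) |
      IsConj (finRotate n) ω ∧ cycleCount (ω * finRotate n) = k}.ncard

namespace ZagierStanley

open Equiv Equiv.Perm Finset Polynomial

theorem sameCycle_of_step {α : Type*} [Finite α] {π : Perm α} {r : Setoid α}
    (h : ∀ x, r x (π x)) {x y : α} (hxy : SameCycle π x y) : r x y := by
  obtain ⟨n, rfl⟩ := hxy.exists_nat_pow_eq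
  induction n with
  | zero => exact r.refl x
  | succ n ih =>
    rw [pow_succ', mul_apply]
    exact r.trans (ih ⟨n, by simp⟩) (h _)

section CycleCount

variable {α : Type*} [Fintype α] [DecidableEq α]

theorem cycleCount_eq_card_fixedPoints_add (σ : Perm α) :
    cycleCount σ = Fintype.card (Function.fixedPoints σ) + σ.cycleFactorsFinset.card := by
  rw [cycleCount, card_fixedPoints, cycleType_def, Multiset.card_map]
  rfl

theorem cycleCount_add_card_support (σ : Perm α) :
    cycleCount σ + σ.support.card = Fintype.card α + σ.cycleType.card := by
  have := σ.sum_cycleType_le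
  rw [cycleCount, ← sum_cycleType]
  omega

/-- The number of cycles is the number of classes of the relation of lying on the same cycle. -/
theorem cycleCount_eq_card_quotient (σ : Perm α) :
    cycleCount σ = Nat.card (Quotient (SameCycle.setoid σ)) := by
  classical
  rw [cycleCount_eq_card_fixedPoints_add, ← Fintype.card_coe σ.cycleFactorsFinset, ← Fintype.card_sum,
    ← Nat.card_eq_fintype_card]
  have hne : ∀ c : σ.cycleFactorsFinset, ∃ x, x ∈ c.1.support := fun c =>
    (mem_cycleFactorsFinset_iff.1 c.2).1.nonempty_support
  choose r hr using hne
  have hc : ∀ c : σ.cycleFactorsFinset, σ.cycleOf (r c) = c.1 := fun c =>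
    (cycle_is_cycleOf (hr c) c.2).symm
  have hmem : ∀ c : σ.cycleFactorsFinset, σ (r c) ≠ r c := fun c =>
    mem_support.1 (mem_cycleFactorsFinset_support_le c.2 (hr c))
  refine Nat.card_congr (Equiv.ofBijective
    (Sum.elim (fun x => Quotient.mk (SameCycle.setoid σ) x.1)
      (fun c => Quotient.mk (SameCycle.setoid σ) (r c))) ⟨?_, ?_⟩)
  · rintro (x | c) (y | d) h
    · have h' : SameCycle σ x.1 y.1 := Quotient.exact h
      exact congrArg Sum.inl (Subtype.ext (h'.eq_of_left x.2))
    · have h' : SameCycle σ x.1 (r d) := Quotient.exact h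
      exact absurd (h'.apply_eq_self_iff.1 x.2) (hmem d)
    · have h' : SameCycle σ (r c) y.1 := Quotient.exact h
      exact absurd (h'.apply_eq_self_iff.2 y.2) (hmem c)
    · have h' : SameCycle σ (r c) (r d) := Quotient.exact h
      refine congrArg Sum.inr (Subtype.ext ?_)
      rw [← hc c, ← hc d, h'.cycleOf_eq]
  · intro q
    induction q using Quotient.inductionOn with
    | h x =>
      by_cases hx : σ x = x
      · exact ⟨Sum.inl ⟨x, hx⟩, rfl⟩
      · have hx' : σ.cycleOf x ∈ σ.cycleFactorsFinset :=
          cycleOf_mem_cycleFactorsFinset_iff.2 (mem_support.2 hx)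
        refine ⟨Sum.inr ⟨_, hx'⟩, Quotient.sound ?_⟩
        have := hr ⟨_, hx'⟩
        exact (mem_support_cycleOf_iff.1 this).1.symm

theorem cycleCount_conj (σ τ : Perm α) : cycleCount (τ * σ * τ⁻¹) = cycleCount σ := by
  simp only [cycleCount, cycleType_conj]

theorem cycleCount_mul_comm (σ τ : Perm α) : cycleCount (σ * τ) = cycleCount (τ * σ) := by
  rw [← cycleCount_conj (σ * τ) τ, mul_assoc, mul_inv_cancel_right]

theorem sign_eq_neg_one_pow_cycleCount (σ : Perm α) :
    ((sign σ : ℤˣ) : ℤ) = (-1) ^ (Fintype.card α + cycleCount σ) := by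
  have h := cycleCount_add_card_support σ
  rw [sign_of_cycleType, sum_cycleType]
  push_cast
  have : σ.support.card + σ.cycleType.card + 2 * (cycleCount σ) =
    Fintype.card α + cycleCount σ + 2 * σ.cycleType.card := by omega
  have h2 : ((-1 : ℤ)) ^ (σ.support.card + σ.cycleType.card + 2 * (cycleCount σ)) =
    (-1) ^ (Fintype.card α + cycleCount σ + 2 * σ.cycleType.card) := by rw [this]
  simpa [pow_add, pow_mul] using h2

theorem sameCycle_swap_mul {π : Perm α} {a b : α} (h : ¬ SameCycle π a b) :
    SameCycle (swap a b * π) a b := by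
  have hex : ∃ k, 0 < k ∧ (π ^ k) a = a := ⟨orderOf π, orderOf_pos π, by simp [pow_orderOf_eq_one]⟩
  classical
  obtain ⟨hk, hka⟩ := Nat.find_spec hex
  have hmin : ∀ j, j < Nat.find hex → ((swap a b * π) ^ j) a = (π ^ j) a := by
    intro j
    induction j with
    | zero => simp
    | succ j ih =>
      intro hj
      rw [pow_succ', mul_apply, ih (by omega), pow_succ', mul_apply, mul_apply]
      apply swap_apply_of_ne_of_ne
      · intro hja
        exact Nat.find_min hex hj ⟨by omega, by rw [pow_succ', mul_apply, hja]⟩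
      · intro hjb
        exact h ⟨(j + 1 : ℕ), by rw [zpow_natCast, pow_succ', mul_apply, hjb]⟩
  obtain ⟨m, hm⟩ : ∃ m, Nat.find hex = m + 1 := ⟨Nat.find hex - 1, by omega⟩
  refine ⟨(m + 1 : ℕ), ?_⟩
  rw [zpow_natCast, pow_succ', mul_apply, hmin m (by omega), mul_apply]
  rw [hm, pow_succ', mul_apply] at hka
  rw [hka, swap_apply_left]

theorem sameCycle_swap_mul_iff {π : Perm α} {a b : α} (h : ¬ SameCycle π a b) (x y : α) :
    SameCycle (swap a b * π) x y ↔ SameCycle π x y ∨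
      (SameCycle π x a ∧ SameCycle π b y) ∨ (SameCycle π x b ∧ SameCycle π a y) := by
  have hab := sameCycle_swap_mul h
  have hstep : ∀ x y, SameCycle π x y → SameCycle (swap a b * π) x y := by
    intro x y hxy
    refine sameCycle_of_step (r := SameCycle.setoid (swap a b * π)) (fun z => ?_) hxy
    change SameCycle _ _ _
    have hz : SameCycle (swap a b * π) z ((swap a b * π) z) := sameCycle_apply_right.2 .rfl
    rw [mul_apply] at hz
    by_cases h1 : π z = a
    · rw [h1, swap_apply_left] at hz
      rw [h1]; exact hz.trans hab.symm
    by_cases h2 : π z = b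
    · rw [h2, swap_apply_right] at hz
      rw [h2]; exact hz.trans hab
    rwa [swap_apply_of_ne_of_ne h1 h2] at hz
  constructor
  · intro hxy
    obtain ⟨n, rfl⟩ := hxy.exists_nat_pow_eq
    clear hxy
    induction n with
    | zero => exact Or.inl .rfl
    | succ n ih =>
      rw [pow_succ', mul_apply]
      generalize ((swap a b * π) ^ n) x = z at ih ⊢
      rw [mul_apply]
      have hz : SameCycle π z (π z) := sameCycle_apply_right.2 .rfl
      by_cases h1 : π z = a
      · rw [h1, swap_apply_left]
        rw [h1] at hz
        rcases ih with ih | ⟨i1, i2⟩ | ⟨i1, i2⟩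
        · exact Or.inr (Or.inl ⟨ih.trans hz, .rfl⟩)
        · exact absurd (i2.trans hz).symm h
        · exact Or.inl i1
      by_cases h2 : π z = b
      · rw [h2, swap_apply_right]
        rw [h2] at hz
        rcases ih with ih | ⟨i1, i2⟩ | ⟨i1, i2⟩
        · exact Or.inr (Or.inr ⟨ih.trans hz, .rfl⟩)
        · exact Or.inl i1
        · exact absurd (i2.trans hz) h
      rw [swap_apply_of_ne_of_ne h1 h2]
      rcases ih with ih | ⟨i1, i2⟩ | ⟨i1, i2⟩
      · exact Or.inl (ih.trans hz)
      · exact Or.inr (Or.inl ⟨i1, i2.trans hz⟩)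
      · exact Or.inr (Or.inr ⟨i1, i2.trans hz⟩)
  · rintro (h1 | ⟨h1, h2⟩ | ⟨h1, h2⟩)
    · exact hstep _ _ h1
    · exact (hstep _ _ h1).trans (hab.trans (hstep _ _ h2))
    · exact (hstep _ _ h1).trans (hab.symm.trans (hstep _ _ h2))

/-- Multiplying by a transposition of points on two different cycles merges these cycles. -/
theorem cycleCount_swap_mul {π : Perm α} {a b : α} (h : ¬ SameCycle π a b) :
    cycleCount (swap a b * π) + 1 = cycleCount π := by
  classical
  rw [cycleCount_eq_card_quotient, cycleCount_eq_card_quotient]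
  let s := SameCycle.setoid π
  let t := SameCycle.setoid (swap a b * π)
  have hst : ∀ x y, s x y → t x y := fun x y hxy => (sameCycle_swap_mul_iff h x y).2 (Or.inl hxy)
  rw [← Finite.card_option]
  refine (Nat.card_congr (Equiv.ofBijective (α := Quotient s) (β := Option (Quotient t))
    (fun q => if q = Quotient.mk s b then none else
      some (Quotient.map (sa := s) (sb := t) id hst q)) ⟨?_, ?_⟩)).symm
  · intro p q
    induction p using Quotient.inductionOn with
    | h x =>
    induction q using Quotient.inductionOn with
    | h y =>
    intro hpq
    by_cases hx : Quotient.mk s x = Quotient.mk s b <;>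
      by_cases hy : Quotient.mk s y = Quotient.mk s b
    · rw [hx, hy]
    · simp [hx, hy] at hpq
    · simp [hx, hy] at hpq
    · simp only [hx, hy, if_false, Option.some.injEq] at hpq
      have h' : SameCycle (swap a b * π) x y := Quotient.exact hpq
      rcases (sameCycle_swap_mul_iff h x y).1 h' with h1 | ⟨h1, h2⟩ | ⟨h1, h2⟩
      · exact Quotient.sound h1
      · exact absurd (Quotient.sound h2.symm) hy
      · exact absurd (Quotient.sound h1) hx
  · rintro (_ | q)
    · exact ⟨Quotient.mk s b, by simp⟩
    · induction q using Quotient.inductionOn with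
      | h x =>
      by_cases hx : Quotient.mk s x = Quotient.mk s b
      · refine ⟨Quotient.mk s a, ?_⟩
        have ha : ¬ Quotient.mk s a = Quotient.mk s b := fun e => h (Quotient.exact e)
        have hxb : SameCycle π x b := Quotient.exact hx
        simp only [ha, if_false, Option.some.injEq]
        exact Quotient.sound ((sameCycle_swap_mul_iff h a x).2 (Or.inr (Or.inl ⟨.rfl, hxb.symm⟩)))
      · exact ⟨Quotient.mk s x, by simp only [hx, if_false]; rfl⟩

theorem cycleCount_subtypeCongr (p : α → Prop) [DecidablePred p] [Fintype {x // p x}]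
    [Fintype {x // ¬ p x}] (σ : Perm {x // p x}) (τ : Perm {x // ¬ p x}) :
    cycleCount (σ.subtypeCongr τ) = cycleCount σ + cycleCount τ := by
  have hmul : σ.subtypeCongr τ = ofSubtype σ * ofSubtype τ := by
    ext x
    by_cases hx : p x
    · rw [Perm.subtypeCongr.left_apply _ _ hx, mul_apply,
        ofSubtype_apply_of_not_mem τ (by simpa using hx), ofSubtype_apply_of_mem σ hx]
    · rw [Perm.subtypeCongr.right_apply _ _ hx, mul_apply, ofSubtype_apply_of_mem τ hx,
        ofSubtype_apply_of_not_mem σ (τ ⟨x, hx⟩).2]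
  have hdis : Disjoint (ofSubtype σ) (ofSubtype τ) := by
    intro x
    by_cases hx : p x
    · exact Or.inr (ofSubtype_apply_of_not_mem τ (by simpa using hx))
    · exact Or.inl (ofSubtype_apply_of_not_mem σ hx)
  have h1 := σ.sum_cycleType_le
  have h2 := τ.sum_cycleType_le
  have h3 := Fintype.card_congr (Equiv.sumCompl p)
  rw [Fintype.card_sum] at h3
  simp only [cycleCount, hmul, hdis.cycleType_mul, cycleType_ofSubtype, Multiset.sum_add,
    Multiset.card_add]
  omega

theorem cycleCount_permCongr {β : Type*} [Fintype β] [DecidableEq β] (e : α ≃ β) (σ : Perm α) :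
    cycleCount (e.permCongr σ) = cycleCount σ := by
  rw [cycleCount_eq_card_quotient, cycleCount_eq_card_quotient]
  refine (Nat.card_congr (Quotient.congr e fun x y => ?_)).symm
  change SameCycle σ x y ↔ SameCycle (e.permCongr σ) (e x) (e y)
  have : ∀ n : ℤ, (e.permCongr σ) ^ n = e.permCongr (σ ^ n) := fun n =>
    (map_zpow e.permCongrHom σ n).symm
  simp [SameCycle, this, Equiv.permCongr_apply]

theorem cycleCount_optionCongr (σ : Perm α) :
    cycleCount (optionCongr σ : Perm (Option α)) = cycleCount σ + 1 := by
  have hext : (optionCongr σ : Perm (Option α)) =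
      σ.extendDomain (Equiv.optionIsSomeEquiv α).symm := by
    ext1 x
    cases x with
    | none => rw [Perm.extendDomain_apply_not_subtype _ _ (by simp)]; rfl
    | some x => rw [Perm.extendDomain_apply_subtype _ _ (by simp)]; simp
  have h := σ.sum_cycleType_le
  rw [cycleCount, cycleCount, hext, cycleType_extendDomain, Fintype.card_option]
  omega

end CycleCount

section GeneratingFunction

theorem sum_pow_cycleCount_fin {R : Type*} [CommRing R] (q : R) (n : ℕ) :
    ∑ σ : Perm (Fin n), q ^ cycleCount σ = ∏ i ∈ range n, (q + i) := by
  induction n with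
  | zero => simp [cycleCount]
  | succ n ih =>
    rw [← Equiv.sum_comp (finSuccEquiv n).symm.permCongr, ← Equiv.sum_comp decomposeOption.symm,
      Fintype.sum_prod_type, Fintype.sum_option, prod_range_succ, ← ih]
    simp only [cycleCount_permCongr, decomposeOption_symm_apply, swap_self]
    have h1 : ∀ σ : Perm (Fin n),
        cycleCount ((Equiv.refl _ : Perm (Option (Fin n))) * optionCongr σ) = cycleCount σ + 1 :=
      fun σ => by rw [← cycleCount_optionCongr]; rfl
    have h2 : ∀ (i : Fin n) (σ : Perm (Fin n)),
        cycleCount (swap none (some i) * optionCongr σ) = cycleCount σ := fun i σ => by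
      have h : ¬ SameCycle (optionCongr σ : Perm (Option (Fin n))) none (some i) := fun h => by
        have := h.eq_of_left (show _ = _ from rfl)
        simp at this
      have := cycleCount_swap_mul h
      rw [cycleCount_optionCongr] at this
      omega
    simp only [h1, h2, pow_succ, ← sum_mul, sum_const, card_univ, Fintype.card_fin]
    rw [nsmul_eq_mul]
    ring

variable {R : Type*} [CommRing R]

theorem sum_pow_cycleCount (α : Type*) [Fintype α] [DecidableEq α] (q : R) :
    ∑ σ : Perm α, q ^ cycleCount σ = ∏ i ∈ range (Fintype.card α), (q + i) := by
  rw [← sum_pow_cycleCount_fin, ← Equiv.sum_comp (Fintype.equivFin α).permCongr]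
  simp only [cycleCount_permCongr]

theorem sum_sign_mul_pow_cycleCount (α : Type*) [Fintype α] [DecidableEq α] (q : R) :
    ∑ σ : Perm α, (((sign σ : ℤˣ) : ℤ) : R) * q ^ cycleCount σ =
      ∏ i ∈ range (Fintype.card α), (q - i) := by
  have h : ∏ i ∈ range (Fintype.card α), (q - i) =
      (-1) ^ Fintype.card α * ∏ i ∈ range (Fintype.card α), (-q + i) := by
    rw [← card_range (Fintype.card α), ← prod_const, card_range, ← prod_mul_distrib]
    exact prod_congr rfl fun i _ => by ring
  rw [h, ← sum_pow_cycleCount, mul_sum]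
  refine sum_congr rfl fun σ _ => ?_
  rw [sign_eq_neg_one_pow_cycleCount, neg_pow q]
  push_cast
  ring

end GeneratingFunction

section Weight

variable {α : Type*} [DecidableEq α]

theorem mem_iff_of_subset {ω : Perm α} {T : Finset α} (h : ∀ x ∈ T, ω x ∈ T) (x : α) :
    ω x ∈ T ↔ x ∈ T := by
  refine ⟨fun hx => ?_, h x⟩
  have himg : T.image ω = T :=
    eq_of_subset_of_card_le (image_subset_iff.2 h) (card_image_of_injective _ ω.injective).ge
  rw [← himg, mem_image] at hx
  obtain ⟨y, hy, hyx⟩ := hx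
  rwa [← ω.injective hyx]

theorem exists_restrict {ω : Perm α} {T : Finset α} (h : ∀ x, ω x ∈ T ↔ x ∈ T) :
    ∃ g : Perm α, (∀ x ∈ T, g x = ω x) ∧ ∀ x ∉ T, g x = x :=
  ⟨ofSubtype (ω.subtypePerm h), fun _ hx => ofSubtype_subtypePerm_of_mem h hx,
    fun _ hx => ofSubtype_subtypePerm_of_not_mem h hx⟩

theorem mem_iff_of_sameCycle {α : Type*} [Finite α] {ω : Perm α} {T : Finset α}
    (h : ∀ x, ω x ∈ T ↔ x ∈ T) {x y : α} (hxy : SameCycle ω x y) : x ∈ T ↔ y ∈ T :=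
  sameCycle_of_step (r := Setoid.comap (· ∈ T) ⟨Iff, Iff.refl, Iff.symm, Iff.trans⟩)
    (fun x => (h x).symm) hxy

variable [Fintype α]

/-- If `ω` preserves `T`, this is `-1` to the number of cycles of `ω` on `T`. -/
def weight (ω : Perm α) (T : Finset α) : ℤ :=
  if h : ∀ x, ω x ∈ T ↔ x ∈ T then (-1) ^ T.card * (sign (ω.subtypePerm h) : ℤˣ) else 0

theorem weight_of_not_invariant {ω : Perm α} {T : Finset α} (h : ¬ ∀ x, ω x ∈ T ↔ x ∈ T) :
    weight ω T = 0 := dif_neg h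

theorem weight_eq {ω g : Perm α} {T : Finset α} (hon : ∀ x ∈ T, g x = ω x)
    (hoff : ∀ x ∉ T, g x = x) : weight ω T = (-1) ^ T.card * (sign g : ℤˣ) := by
  have hgT : ∀ x ∈ T, g x ∈ T := fun x hx => by
    by_contra hgx
    exact hgx (by rwa [g.injective (hoff _ hgx)])
  have hg := mem_iff_of_subset hgT
  have hω : ∀ x, ω x ∈ T ↔ x ∈ T := mem_iff_of_subset fun x hx => hon x hx ▸ hgT x hx
  rw [weight, dif_pos hω, ← sign_subtypePerm g hg fun x hx => by_contra fun h => hx (hoff x h)]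
  have hsub : ω.subtypePerm hω = g.subtypePerm hg := Perm.ext fun x =>
    Subtype.ext (hon x x.2).symm
  rw [hsub]
  congr!

theorem weight_empty (ω : Perm α) : weight ω ∅ = 1 := by
  rw [weight_eq (g := 1) (by simp) (by simp)]
  simp

theorem sign_cycleOf (ω : Perm α) (x : α) :
    ((sign (ω.cycleOf x) : ℤˣ) : ℤ) = -(-1) ^ (univ.filter (SameCycle ω x)).card := by
  by_cases hx : ω x = x
  · have : univ.filter (SameCycle ω x) = {x} := by
      ext y
      simp only [mem_filter, mem_univ, true_and, mem_singleton]
      exact ⟨fun h => (h.eq_of_left hx).symm, fun h => h ▸ .rfl⟩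
    rw [(cycleOf_eq_one_iff ω).2 hx, this]
    simp
  · have : (ω.cycleOf x).support = univ.filter (SameCycle ω x) := by
      ext y
      rw [mem_support_cycleOf_iff]
      simp [hx]
    rw [(isCycle_cycleOf ω hx).sign, this]
    simp

theorem weight_union_cycle {ω : Perm α} {T : Finset α} {x : α} (h : ∀ y, ω y ∈ T ↔ y ∈ T)
    (hx : x ∉ T) : weight ω (T ∪ univ.filter (SameCycle ω x)) = -weight ω T := by
  obtain ⟨g, hon, hoff⟩ := exists_restrict h
  have hT : ∀ y, SameCycle ω x y → y ∉ T := fun y hy => (mem_iff_of_sameCycle h hy).not.1 hx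
  have hdis : Disjoint T (univ.filter (SameCycle ω x)) :=
    disjoint_left.2 fun y hy hy' => hT y (by simpa using hy') hy
  rw [weight_eq hon hoff, weight_eq (g := g * ω.cycleOf x), card_union_of_disjoint hdis, map_mul,
    Units.val_mul, sign_cycleOf, pow_add]
  · have : ((-1 : ℤ) ^ (univ.filter (SameCycle ω x)).card) *
      (-1 : ℤ) ^ (univ.filter (SameCycle ω x)).card = 1 := by
      rw [← mul_pow]; simp
    linear_combination (-(-1) ^ T.card * ((sign g : ℤˣ) : ℤ)) * this
  · intro y hy
    rw [mul_apply]
    rcases mem_union.1 hy with hy | hy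
    · rw [cycleOf_apply_of_not_sameCycle fun h' => hT y h' hy, hon y hy]
    · have hy : SameCycle ω x y := by simpa using hy
      rw [hy.cycleOf_apply, hoff _ (hT _ (sameCycle_apply_right.2 hy))]
  · intro y hy
    rw [mem_union, not_or] at hy
    rw [mul_apply, cycleOf_apply_of_not_sameCycle (by simpa using hy.2), hoff y hy.1]

/-- Inclusion-exclusion over invariant sets detects full cycles. -/
theorem sum_weight (ω : Perm α) (p : α) :
    ∑ T ∈ univ.filter (fun T : Finset α => p ∉ T), weight ω T =
      if ∀ x, SameCycle ω p x then 1 else 0 := by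
  split_ifs with hω
  · rw [sum_eq_single ∅, weight_empty]
    · intro T hT hne
      obtain ⟨x, hx⟩ := nonempty_iff_ne_empty.2 hne
      refine weight_of_not_invariant fun h => ?_
      exact (mem_filter.1 hT).2 ((mem_iff_of_sameCycle h (hω x)).2 hx)
    · simp
  · push Not at hω
    obtain ⟨x, hx⟩ := hω
    set C := univ.filter (SameCycle ω x) with hC
    have hxC : x ∈ C := by simp [hC, SameCycle.refl]
    have hCinv : ∀ y, ω y ∈ C ↔ y ∈ C := fun y => by simp [hC, sameCycle_apply_right]
    have hinv : ∀ T : Finset α, (∀ y, ω y ∈ T ↔ y ∈ T) →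
        ∀ y, ω y ∈ symmDiff T C ↔ y ∈ symmDiff T C :=
      fun T hT y => by simp only [mem_symmDiff, hT, hCinv]
    have hkey : ∀ T : Finset α, (∀ y, ω y ∈ T ↔ y ∈ T) → x ∉ T →
        weight ω (symmDiff T C) = -weight ω T := fun T hT hxT => by
      rw [← weight_union_cycle hT hxT]
      congr 1
      refine Disjoint.symmDiff_eq_sup (disjoint_left.2 fun y hy hy' => ?_)
      exact hxT ((mem_iff_of_sameCycle hT (by simpa [hC] using hy')).2 hy)
    refine sum_involution (fun T _ => symmDiff T C) (fun T _ => ?_) (fun T _ _ h => ?_)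
      (fun T hT => ?_) (fun T _ => symmDiff_symmDiff_cancel_right C T)
    · by_cases hT : ∀ y, ω y ∈ T ↔ y ∈ T
      · by_cases hxT : x ∈ T
        · have := hkey _ (hinv T hT) (by simp [mem_symmDiff, hxT, hxC])
          rw [symmDiff_symmDiff_cancel_right] at this
          rw [this, neg_add_cancel]
        · rw [hkey T hT hxT, add_neg_cancel]
      · rw [weight_of_not_invariant hT, weight_of_not_invariant, add_zero]
        intro h
        have := hinv _ h
        rw [symmDiff_symmDiff_cancel_right] at this
        exact hT this
    · rw [symmDiff_eq_left] at h
      rw [h] at hxC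
      simp at hxC
    · simp only [mem_filter, mem_univ, true_and, mem_symmDiff] at hT ⊢
      rintro (h | h)
      · exact hT h.1
      · exact hx (by simpa [hC] using h.1 : SameCycle ω x p).symm

theorem sum_weight_mul {R : Type*} [CommRing R] (T : Finset α) (F : Perm α → R) :
    ∑ ω, (weight ω T : R) * F ω = (-1) ^ T.card *
      ∑ σ : Perm {x // x ∈ T}, ∑ τ : Perm {x // x ∉ T},
        (((sign σ : ℤˣ) : ℤ) : R) * F (σ.subtypeCongr τ) := by
  have hw : ∀ (σ : Perm {x // x ∈ T}) (τ : Perm {x // x ∉ T}),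
      weight (σ.subtypeCongr τ) T = (-1) ^ T.card * (sign σ : ℤˣ) := fun σ τ => by
    rw [weight_eq (g := ofSubtype σ), sign_ofSubtype]
    · intro x hx
      rw [ofSubtype_apply_of_mem σ hx, Perm.subtypeCongr.left_apply _ _ hx]
    · exact fun x hx => ofSubtype_apply_of_not_mem σ hx
  rw [← Fintype.sum_prod_type', mul_sum]
  refine (sum_of_injOn (fun s : Perm {x // x ∈ T} × Perm {x // x ∉ T} => s.1.subtypeCongr s.2)
    ?_ ?_ ?_ ?_).symm
  · exact (subtypeCongrHom_injective (· ∈ T)).injOn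
  · simp
  · intro ω _ hω
    rw [weight_of_not_invariant, Int.cast_zero, zero_mul]
    refine fun h => hω ⟨(ω.subtypePerm h, ω.subtypePerm fun x => (h x).not), by simp, ?_⟩
    ext x
    by_cases hx : x ∈ T
    · simp [Perm.subtypeCongr.left_apply _ _ hx]
    · simp [Perm.subtypeCongr.right_apply _ _ hx]
  · rintro ⟨σ, τ⟩ -
    simp only [hw]
    push_cast
    ring

end Weight

section Product

variable {α : Type*} [Fintype α] [DecidableEq α]

theorem weight_mul {ω g c : Perm α} {T : Finset α} (hon : ∀ x ∈ T, g x = c x)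
    (hoff : ∀ x ∉ T, g x = x) : weight (c * ω) T = (sign g : ℤˣ) * weight ω T := by
  have hgT : ∀ x, c x ∈ T ↔ x ∈ T := mem_iff_of_subset fun x hx => by
    by_contra h
    rw [← hon x hx] at h
    exact h (by rwa [g.injective (hoff _ h)])
  by_cases h : ∀ x, ω x ∈ T ↔ x ∈ T
  · obtain ⟨f, hf, hf'⟩ := exists_restrict h
    rw [weight_eq hf hf', weight_eq (g := g * f), map_mul, Units.val_mul, mul_left_comm]
    · intro x hx
      rw [mul_apply, hf x hx, hon _ ((h x).2 hx), mul_apply]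
    · intro x hx
      rw [mul_apply, hf' x hx, hoff x hx]
  · rw [weight_of_not_invariant h, weight_of_not_invariant, mul_zero]
    simpa only [mul_apply, hgT] using h

theorem sum_weight_of_two_exits (c : Perm α) {T : Finset α} {s t : α} (hs : s ∈ T) (ht : t ∈ T)
    (hst : s ≠ t) (hcs : c s ∉ T) (hct : c t ∉ T) :
    ∑ ω, (weight ω T : ℤ[X]) * X ^ cycleCount (ω * c) = 0 := by
  have hne : ∀ {x y : α}, x ∈ T → y ∉ T → x ≠ y := fun hx hy h => hy (h ▸ hx)
  have hright : ∀ ω : Perm α, weight (ω * swap (c s) (c t)) T = weight ω T := fun ω => by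
    have hfix : ∀ x ∈ T, swap (c s) (c t) x = x := fun x hx =>
      swap_apply_of_ne_of_ne (hne hx hcs) (hne hx hct)
    by_cases h : ∀ x, ω x ∈ T ↔ x ∈ T
    · obtain ⟨f, hf, hf'⟩ := exists_restrict h
      rw [weight_eq hf hf', weight_eq (fun x hx => ?_) hf']
      rw [mul_apply, hfix x hx, hf x hx]
    · rw [weight_of_not_invariant h, weight_of_not_invariant]
      refine fun h' => h (mem_iff_of_subset fun x hx => ?_)
      have := (h' x).2 hx
      rwa [mul_apply, hfix x hx] at this
  have hleft : ∀ ω : Perm α, weight (swap s t * ω) T = -weight ω T := fun ω => by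
    rw [weight_mul (g := swap s t) (fun _ _ => rfl), sign_swap hst]
    · simp
    · exact fun x hx => swap_apply_of_ne_of_ne (hne hs hx).symm (hne ht hx).symm
  rw [← self_eq_neg, ← sum_neg_distrib]
  conv_lhs => rw [← Equiv.sum_comp (Equiv.mulLeft (swap s t)),
    ← Equiv.sum_comp (Equiv.mulRight (swap (c s) (c t)))]
  refine sum_congr rfl fun ω _ => ?_
  have hc : cycleCount (swap s t * (ω * swap (c s) (c t)) * c) = cycleCount (ω * c) := by
    have : swap s t * (ω * swap (c s) (c t)) * c = swap s t * (ω * c) * (swap s t)⁻¹ := by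
      have h := mul_swap_eq_swap_mul c s t
      rw [swap_inv, mul_assoc, mul_assoc ω, ← h]
      group
    rw [this, cycleCount_conj]
  simp only [Equiv.coe_mulLeft, Equiv.coe_mulRight, hleft, hright, hc]
  push_cast
  ring

theorem sum_weight_of_one_exit (c : Perm α) {T : Finset α} {a b : α} (ha : a ∈ T) (hb : b ∉ T)
    {g : Perm α} (hon : ∀ x ∈ T, g x = swap a b (c x)) (hoff : ∀ x ∉ T, g x = x)
    (hsign : ((sign g : ℤˣ) : ℤ) * (-1) ^ T.card = -1) :
    X * ∑ ω, (weight ω T : ℤ[X]) * X ^ cycleCount (ω * c) =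
      -((∏ i ∈ range T.card, (X - (i : ℤ[X]))) *
        ∏ i ∈ range (Fintype.card α - T.card), (X + (i : ℤ[X]))) := by
  have hterm : ∀ π : Perm α, X * ((weight ((swap a b * c)⁻¹ * π) T : ℤ[X]) *
      X ^ cycleCount ((swap a b * c)⁻¹ * π * c)) =
      (((sign g : ℤˣ) : ℤ) : ℤ[X]) * ((weight π T : ℤ[X]) * X ^ cycleCount π) := fun π => by
    have hw : weight ((swap a b * c)⁻¹ * π) T = (sign g : ℤˣ) * weight π T := by
      have h := weight_mul (ω := (swap a b * c)⁻¹ * π) (c := swap a b * c) hon hoff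
      rw [mul_inv_cancel_left] at h
      rw [h, ← mul_assoc, ← Units.val_mul, Int.units_mul_self, Units.val_one, one_mul]
    have hc : cycleCount ((swap a b * c)⁻¹ * π * c) = cycleCount (swap a b * π) := by
      rw [← cycleCount_mul_comm π, ← cycleCount_conj (π * swap a b) (swap a b * c)⁻¹]
      congr 1
      rw [inv_inv]
      simp only [mul_assoc, swap_mul_self_mul]
    rw [hw, hc]
    by_cases h : ∀ x, π x ∈ T ↔ x ∈ T
    · rw [← cycleCount_swap_mul fun hab => hb ((mem_iff_of_sameCycle h hab).1 ha)]
      push_cast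
      ring
    · rw [weight_of_not_invariant h]
      simp
  rw [← Equiv.sum_comp (Equiv.mulLeft (swap a b * c)⁻¹), mul_sum]
  simp only [Equiv.coe_mulLeft, hterm]
  rw [← mul_sum, sum_weight_mul]
  simp only [cycleCount_subtypeCongr, pow_add, ← mul_assoc]
  simp only [← mul_sum, ← sum_mul]
  rw [sum_pow_cycleCount, mul_assoc, sum_sign_mul_pow_cycleCount, ← mul_assoc]
  have hs : (((sign g : ℤˣ) : ℤ) : ℤ[X]) * (-1) ^ T.card = -1 := by exact_mod_cast hsign
  rw [hs, Fintype.card_subtype_compl, Fintype.card_coe]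
  ring

end Product

section Intervals

variable {m : ℕ}

theorem sum_weight_Ico {a b : Fin (m + 1)} (hab : a < b) :
    X * ∑ ω, (weight ω (Ico a b) : ℤ[X]) * X ^ cycleCount (ω * finRotate (m + 1)) =
      -((∏ i ∈ range (b - a : ℕ), (X - (i : ℤ[X]))) *
        ∏ i ∈ range (m + 1 - (b - a)), (X + (i : ℤ[X]))) := by
  have hab' : a.val < b.val := hab
  have hlt := b.isLt
  let l : Fin (m + 1) := ⟨b - 1, by omega⟩
  have hl : l.val = b - 1 := rfl
  have hal : a ≤ l := Fin.le_def.2 (by omega)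
  have h := sum_weight_of_one_exit (finRotate (m + 1)) (T := Ico a b) (a := a) (b := b)
    (g := Fin.cycleIcc a l) (by simp [hab]) (by simp) ?_ ?_ ?_
  · rwa [Fin.card_Ico, Fintype.card_fin] at h
  · intro x hx
    obtain ⟨hax, hxb⟩ := mem_Ico.1 hx
    have hxb' : x.val < b.val := hxb
    have hax' : a.val ≤ x.val := hax
    have hrot : (finRotate (m + 1) x).val = x + 1 :=
      coe_finRotate_of_ne_last (Fin.ne_of_val_ne (by rw [Fin.val_last]; omega))
    by_cases hxl : x = l
    · have : finRotate (m + 1) x = b := Fin.ext (by rw [hrot, hxl, hl]; omega)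
      rw [this, swap_apply_right, hxl, Fin.cycleIcc_of_last hal]
    · have hxl' : x < l := by
        have : x.val ≠ l.val := Fin.val_ne_of_ne hxl
        exact Fin.lt_def.2 (by omega)
      have hxl'' : x.val < l.val := hxl'
      rw [Fin.cycleIcc_of_ge_of_lt hax hxl', swap_apply_of_ne_of_ne, finRotate_apply]
      · exact Fin.ne_of_val_ne (by rw [hrot]; omega)
      · exact Fin.ne_of_val_ne (by rw [hrot]; omega)
  · intro x hx
    rw [mem_Ico, not_and_or, not_le, not_lt] at hx
    rcases hx with hx | hx
    · exact Fin.cycleIcc_of_lt hx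
    · have hx' : b.val ≤ x.val := hx
      exact Fin.cycleIcc_of_gt (Fin.lt_def.2 (by omega))
  · rw [Fin.sign_cycleIcc_of_le hal, Fin.card_Ico, hl]
    obtain ⟨r, hr⟩ : ∃ r, b.val - a.val = r + 1 := ⟨b - a - 1, by omega⟩
    rw [show b.val - 1 - a.val = r by omega, hr]
    push_cast
    rw [pow_succ, ← mul_assoc, ← mul_pow]
    simp

theorem eq_empty_or_eq_Ico {T : Finset (Fin (m + 1))} (hlast : Fin.last m ∉ T)
    (h : ∀ s ∈ T, ∀ t ∈ T, finRotate (m + 1) s ∉ T → finRotate (m + 1) t ∉ T → s = t) :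
    T = ∅ ∨ ∃ a b, a < b ∧ T = Ico a b := by
  rcases T.eq_empty_or_nonempty with hT | hT
  · exact Or.inl hT
  have hrot : ∀ x ∈ T, (finRotate (m + 1) x).val = x + 1 := fun x hx =>
    coe_finRotate_of_ne_last fun hx' => hlast (hx' ▸ hx)
  have hexit : ∀ y ∉ T, ∀ x ∈ T, x < y → ∃ z ∈ T, z < y ∧ finRotate (m + 1) z ∉ T := by
    intro y hy x hx hxy
    have hne : (T.filter (· < y)).Nonempty := ⟨x, by simp [hx, hxy]⟩
    have hz := max'_mem _ hne
    have hmax : ∀ w ∈ T.filter (· < y), w ≤ (T.filter (· < y)).max' hne := fun w hw =>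
      le_max' _ w hw
    generalize (T.filter (· < y)).max' hne = z at hz hmax
    obtain ⟨hzT, hzy⟩ := mem_filter.1 hz
    refine ⟨z, hzT, hzy, fun hzr => ?_⟩
    have hr := hrot z hzT
    have hzy' : z.val < y.val := hzy
    by_cases hy' : finRotate (m + 1) z = y
    · exact hy (hy' ▸ hzr)
    · have hle : (finRotate (m + 1) z).val ≤ z.val := hmax _ (by
        have := Fin.val_ne_of_ne hy'
        exact mem_filter.2 ⟨hzr, Fin.lt_def.2 (by omega)⟩)
      omega
  have hM := max'_mem T hT
  have hMmax : ∀ w ∈ T, w ≤ T.max' hT := fun w hw => le_max' T w hw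
  have hmin : ∀ w ∈ T, T.min' hT ≤ w := fun w hw => min'_le T w hw
  have ha := min'_mem T hT
  generalize T.max' hT = M at hM hMmax
  generalize T.min' hT = a at ha hmin
  have hMr := hrot M hM
  have hMout : finRotate (m + 1) M ∉ T := fun hMT => by
    have : (finRotate (m + 1) M).val ≤ M.val := hMmax _ hMT
    omega
  have haM : a.val ≤ M.val := hmin M hM
  refine Or.inr ⟨a, finRotate (m + 1) M, Fin.lt_def.2 (by omega), ?_⟩
  ext y
  rw [mem_Ico]
  constructor
  · intro hy
    have : y.val ≤ M.val := hMmax y hy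
    exact ⟨hmin y hy, Fin.lt_def.2 (by omega)⟩
  · rintro ⟨hay, hyM⟩
    by_contra hy
    obtain ⟨z, hz, hzy, hzr⟩ := hexit y hy a ha (lt_of_le_of_ne hay fun e => hy (e ▸ ha))
    have hzM := h z hz M hM hzr hMout
    have h1 : z.val < y.val := hzy
    have h2 : y.val < (finRotate (m + 1) M).val := hyM
    rw [hzM] at h1
    omega

theorem sum_eq_sum_Ico {R : Type*} [AddCommMonoid R] (G : Finset (Fin (m + 1)) → R)
    (hG : ∀ T : Finset (Fin (m + 1)), ∀ s ∈ T, ∀ t ∈ T, s ≠ t → finRotate (m + 1) s ∉ T →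
      finRotate (m + 1) t ∉ T → G T = 0) :
    ∑ T ∈ univ.filter (fun T => Fin.last m ∉ T), G T =
      G ∅ + ∑ b : Fin (m + 1), ∑ a : Fin (m + 1), if a < b then G (Ico a b) else 0 := by
  rw [← add_sum_erase _ _ (show ∅ ∈ univ.filter (fun T => Fin.last m ∉ T) by simp),
    ← Fintype.sum_prod_type' (f := fun b a : Fin (m + 1) => if a < b then G (Ico a b) else 0),
    ← sum_filter]
  congr 1
  symm
  refine sum_of_injOn (fun s : Fin (m + 1) × Fin (m + 1) => Ico s.2 s.1) ?_ ?_ ?_ ?_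
  · rintro ⟨b, a⟩ hs ⟨b', a'⟩ hs' heq
    replace hs : a < b := (mem_filter.1 (mem_coe.1 hs)).2
    have h : Set.Ico a b = Set.Ico a' b' := by
      simpa using congrArg (fun T : Finset _ => (T : Set (Fin (m + 1)))) heq
    obtain ⟨h1, h2⟩ := (Set.Ico_eq_Ico_iff (Or.inl hs)).1 h
    rw [h1, h2]
  · rintro ⟨b, a⟩ hs
    replace hs : a < b := (mem_filter.1 (mem_coe.1 hs)).2
    simp [hs, Fin.le_last]
  · intro T hT hTI
    simp only [mem_erase, mem_filter, mem_univ, true_and] at hT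
    by_contra hGT
    rcases eq_empty_or_eq_Ico hT.2 (fun s hs t ht h1 h2 => by_contra fun hst =>
      hGT (hG T s hs t ht hst h1 h2)) with h | ⟨a, b, hab, h⟩
    · exact hT.1 h
    · exact hTI ⟨(b, a), by simpa using hab, h.symm⟩
  · simp

end Intervals

section Count

theorem sum_sum_ite_sub {R : Type*} [AddCommMonoid R] (n : ℕ) (f : ℕ → R) :
    ∑ b : Fin n, ∑ a : Fin n, (if a < b then f (b - a : ℕ) else 0) =
      ∑ b ∈ range n, ∑ j ∈ range b, f (j + 1) := by
  rw [← Fin.sum_univ_eq_sum_range (fun b => ∑ j ∈ range b, f (j + 1))]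
  refine sum_congr rfl fun b _ => ?_
  simp only [Fin.lt_def]
  rw [Fin.sum_univ_eq_sum_range (fun a => if a < b.val then f (b - a) else 0), ← sum_filter,
    ← sum_range_reflect]
  have hb := b.isLt
  have h : (range n).filter (· < b.val) = range b := by
    ext x
    simp only [mem_filter, mem_range]
    omega
  rw [h]
  refine sum_congr rfl fun j hj => ?_
  have := mem_range.1 hj
  congr 1
  omega

theorem telescoping_identity (n : ℕ) :
    ((n : ℤ[X]) * ((n : ℤ[X]) + 1)) * (X * ∏ i ∈ range n, (X + (i : ℤ[X])) -
      ∑ b ∈ range n, ∑ j ∈ range b, (∏ i ∈ range (j + 1), (X - (i : ℤ[X]))) *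
        ∏ i ∈ range (n - (j + 1)), (X + (i : ℤ[X]))) =
      X * (∏ i ∈ range (n + 1), (X + (i : ℤ[X])) - ∏ i ∈ range (n + 1), (X - (i : ℤ[X]))) := by
  let F : ℕ → ℤ[X] := fun r => ∏ i ∈ range r, (X - (i : ℤ[X]))
  let U : ℕ → ℤ[X] := fun r => ∏ i ∈ range r, (X + (i : ℤ[X]))
  have hF : ∀ r, F (r + 1) = F r * (X - (r : ℤ[X])) := fun r => prod_range_succ _ _
  have hU : ∀ r, U (r + 1) = U r * (X + (r : ℤ[X])) := fun r => prod_range_succ _ _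
  have hF1 : F 1 = X := by simp [F]
  have hU1 : U 1 = X := by simp [U]
  have hstep : ∀ N r : ℕ, r ≤ N →
      (N : ℤ[X]) * (F r * U (N - r)) = F r * U (N + 1 - r) - F (r + 1) * U (N - r) := by
    intro N r hr
    obtain ⟨d, rfl⟩ := Nat.exists_eq_add_of_le hr
    rw [show r + d + 1 - r = d + 1 by omega, show r + d - r = d by omega, hF, hU]
    push_cast
    ring
  change ((n : ℤ[X]) * ((n : ℤ[X]) + 1)) * (X * U n - ∑ b ∈ range n, ∑ j ∈ range b,
    F (j + 1) * U (n - (j + 1))) = X * (U (n + 1) - F (n + 1))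
  have hinner : ∀ b ∈ range n, (n : ℤ[X]) * ∑ j ∈ range b, F (j + 1) * U (n - (j + 1)) =
      X * U n - F (b + 1) * U (n - b) := by
    intro b hb
    have hb := mem_range.1 hb
    have h := sum_range_sub' (fun j => F (j + 1) * U (n - j)) b
    rw [hF1, Nat.sub_zero] at h
    rw [← h, mul_sum]
    refine sum_congr rfl fun j hj => ?_
    have hj := mem_range.1 hj
    rw [hstep n (j + 1) (by omega), show n + 1 - (j + 1) = n - j by omega]
  have hsum : (n : ℤ[X]) * (X * U n - ∑ b ∈ range n, ∑ j ∈ range b,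
      F (j + 1) * U (n - (j + 1))) = ∑ b ∈ range n, F (b + 1) * U (n - b) := by
    rw [mul_sub, mul_sum, sum_congr rfl hinner, sum_sub_distrib, sum_const, card_range,
      nsmul_eq_mul]
    ring
  have houter := sum_range_sub' (fun b => F (b + 1) * U (n + 1 - b)) n
  rw [hF1, Nat.sub_zero, show n + 1 - n = 1 by omega, hU1] at houter
  rw [mul_right_comm, hsum, mul_comm, mul_sum, mul_sub, mul_comm X (F (n + 1)), ← houter]
  refine sum_congr rfl fun b hb => ?_
  have hb := mem_range.1 hb
  have h := hstep (n + 1) (b + 1) (by omega)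
  rw [show n + 1 - (b + 1) = n - b by omega, show n + 1 + 1 - (b + 1) = n + 1 - b by omega] at h
  rw [show n + 1 - (b + 1) = n - b by omega, ← h]
  push_cast
  ring

theorem sum_full_cycles (m : ℕ) :
    (((m + 1 : ℕ) : ℤ[X]) * (((m + 1 : ℕ) : ℤ[X]) + 1)) *
      ∑ ω : Perm (Fin (m + 1)), (if ∀ x, SameCycle ω (Fin.last m) x then
        X ^ cycleCount (ω * finRotate (m + 1)) else 0) =
      ∏ i ∈ range (m + 1 + 1), (X + (i : ℤ[X])) - ∏ i ∈ range (m + 1 + 1), (X - (i : ℤ[X])) := by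
  refine mul_left_cancel₀ (X_ne_zero (R := ℤ)) ?_
  rw [← telescoping_identity, mul_left_comm]
  congr 1
  let G : Finset (Fin (m + 1)) → ℤ[X] := fun T =>
    ∑ ω, (weight ω T : ℤ[X]) * X ^ cycleCount (ω * finRotate (m + 1))
  have hsum : ∑ ω : Perm (Fin (m + 1)), (if ∀ x, SameCycle ω (Fin.last m) x then
      (X : ℤ[X]) ^ cycleCount (ω * finRotate (m + 1)) else 0) =
      ∑ T ∈ univ.filter (fun T => Fin.last m ∉ T), G T := by
    rw [sum_comm]
    refine sum_congr rfl fun ω _ => ?_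
    rw [← sum_mul, ← Int.cast_sum, sum_weight]
    split_ifs <;> simp
  have hempty : G ∅ = ∏ i ∈ range (m + 1), (X + (i : ℤ[X])) := by
    have h := sum_pow_cycleCount (Fin (m + 1)) (X : ℤ[X])
    rw [Fintype.card_fin, ← Equiv.sum_comp (Equiv.mulRight (finRotate (m + 1)))] at h
    rw [← h]
    simp [G, weight_empty]
  rw [hsum, sum_eq_sum_Ico G fun T s hs t ht hst h1 h2 =>
    sum_weight_of_two_exits _ hs ht hst h1 h2, hempty, mul_add, sub_eq_add_neg, mul_sum,
    ← sum_sum_ite_sub _ fun r => (∏ i ∈ range r, (X - (i : ℤ[X]))) *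
      ∏ i ∈ range (m + 1 - r), (X + (i : ℤ[X])), ← sum_neg_distrib]
  congr 1
  refine sum_congr rfl fun b _ => ?_
  rw [mul_sum, ← sum_neg_distrib]
  refine sum_congr rfl fun a _ => ?_
  split_ifs with hab
  · exact sum_weight_Ico hab
  · simp

theorem isConj_finRotate_iff {m : ℕ} (ω : Perm (Fin (m + 1))) :
    IsConj (finRotate (m + 1)) ω ↔ ∀ x, SameCycle ω (Fin.last m) x := by
  cases m with
  | zero =>
    have : Subsingleton (Fin (0 + 1)) := inferInstanceAs (Subsingleton (Fin 1))
    have h : finRotate (0 + 1) = ω := Subsingleton.elim _ _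
    rw [h]
    exact ⟨fun _ x => Subsingleton.elim (Fin.last 0) x ▸ .rfl, fun _ => IsConj.refl _⟩
  | succ m =>
    rw [isConj_iff_cycleType_eq, cycleType_finRotate]
    constructor
    · intro h x
      have hcyc : ω.IsCycle := card_cycleType_eq_one.1 (by rw [← h]; rfl)
      have hsupp : ω.support = univ := by
        rw [← card_eq_iff_eq_univ, Fintype.card_fin, ← sum_cycleType, ← h, Multiset.sum_singleton]
      have hne : ∀ y, ω y ≠ y := fun y => mem_support.1 (hsupp ▸ mem_univ y)
      exact hcyc.sameCycle (hne _) (hne _)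
    · intro h
      have hne : ∀ y, ω y ≠ y := fun y hy => by
        have heq : ∀ x, x = y := fun x => (((h y).symm.trans (h x)).eq_of_left hy).symm
        exact absurd ((heq 0).trans (heq (Fin.last _)).symm) (Fin.last_pos.ne)
      have hcyc : ω.IsCycle := ⟨Fin.last _, hne _, fun y _ => h y⟩
      have hsupp : ω.support = univ := eq_univ_iff_forall.2 fun y => mem_support.2 (hne y)
      rw [hcyc.cycleType, hsupp, card_univ, Fintype.card_fin]

theorem coeff_sum_full_cycles (m k : ℕ) :
    (∑ ω : Perm (Fin (m + 1)), (if ∀ x, SameCycle ω (Fin.last m) x then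
      (X : ℤ[X]) ^ cycleCount (ω * finRotate (m + 1)) else 0)).coeff k =
        (xi (m + 1) k : ℤ) := by
  have hxi : xi (m + 1) k = (univ.filter fun ω : Perm (Fin (m + 1)) =>
      (∀ x, SameCycle ω (Fin.last m) x) ∧ cycleCount (ω * finRotate (m + 1)) = k).card := by
    rw [xi, ← Set.ncard_coe_finset]
    congr 1
    ext ω
    simp only [Set.mem_ofPred_eq, coe_filter, mem_univ, true_and, isConj_finRotate_iff]
  rw [hxi, finsetSum_coeff, card_filter, Nat.cast_sum]
  refine sum_congr rfl fun ω _ => ?_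
  by_cases h : ∀ x, SameCycle ω (Fin.last m) x
  · simp [h, coeff_X_pow, eq_comm]
  · simp [h]

theorem coeff_rising_sub_falling (n k : ℕ) (h : Odd (n + k)) :
    (∏ i ∈ range n, (X + (i : ℤ[X])) - ∏ i ∈ range n, (X - (i : ℤ[X])) : ℤ[X]).coeff k =
      2 * (stirling1 n k : ℤ) := by
  have h1 := sum_pow_cycleCount (Fin n) (X : ℤ[X])
  have h2 := sum_sign_mul_pow_cycleCount (Fin n) (X : ℤ[X])
  rw [Fintype.card_fin] at h1 h2
  rw [← h1, ← h2, ← sum_sub_distrib, finsetSum_coeff, stirling1, card_filter, Nat.cast_sum,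
    mul_sum]
  refine sum_congr rfl fun σ _ => ?_
  rw [coeff_sub, coeff_intCast_mul, coeff_X_pow]
  by_cases hσ : cycleCount σ = k
  · rw [sign_eq_neg_one_pow_cycleCount, hσ, Fintype.card_fin, h.neg_one_pow]
    simp
  · simp [hσ, Ne.symm hσ]

end Count

end ZagierStanley

/-- **Zagier–Stanley.**  For `n, k ≥ 1` with `n - k` even,
`ξ_{1,k}(n) = 2·C(n+1, k) / (n(n+1))`, stated multiplicatively. -/
theorem zagier_stanley (n k : ℕ) (hn : 1 ≤ n) (hk : 1 ≤ k)
    (h : Even (n + k)) :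
    n * (n + 1) * xi n k = 2 * stirling1 (n + 1) k := by
  obtain ⟨m, rfl⟩ : ∃ m, n = m + 1 := ⟨n - 1, by omega⟩
  have hodd : Odd (m + 1 + 1 + k) := by
    rw [add_right_comm]
    exact h.add_one
  have hcoeff := congrArg (fun p => Polynomial.coeff p k) (ZagierStanley.sum_full_cycles m)
  simp only [ZagierStanley.coeff_rising_sub_falling _ _ hodd] at hcoeff
  rw [← Nat.cast_succ, ← Nat.cast_mul, Polynomial.coeff_natCast_mul,
    ZagierStanley.coeff_sum_full_cycles] at hcoeff
  exact_mod_cast hcoeff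
end

section
/- For a permutation of cycle type 1^{a_1} 2^{a_2} on [n] (i.e., all cycles of length at most 2), the number of ways to write it as a product of two n-cycles equals (n-1)! / (n + 1 - a_1 - a_2). -/
namespace FullCycle

open Finset Equiv Equiv.Perm

variable {α : Type*}

/-- A permutation all of whose points lie on a single cycle. -/
def IsFull (f : Perm α) : Prop := ∀ x y, f.SameCycle x y

lemma IsFull.inv {f : Perm α} (h : IsFull f) : IsFull f⁻¹ := fun x y => (h x y).inv

lemma mem_of_sameCycle [Finite α] {f : Perm α} {S : Set α} (hS : ∀ a ∈ S, f a ∈ S) {x y : α}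
    (hx : x ∈ S) (h : f.SameCycle x y) : y ∈ S := by
  obtain ⟨i, rfl⟩ := h.exists_nat_pow_eq
  induction i with
  | zero => simpa
  | succ i ih =>
    rw [pow_succ', Perm.mul_apply]
    exact hS _ (ih ⟨i, by simp⟩)

section Count
variable [Fintype α] [DecidableEq α]

lemma isFull_iff_cycleType (h2 : 2 ≤ Fintype.card α) (f : Perm α) :
    IsFull f ↔ f.cycleType = {Fintype.card α} := by
  have : Nontrivial α := Fintype.one_lt_card_iff_nontrivial.1 h2
  constructor
  · intro h
    have hne : ∀ z, f z ≠ z := by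
      intro z hz
      obtain ⟨w, hw⟩ := exists_ne z
      have := mem_of_sameCycle (S := {z}) (f := f) (by simpa using hz) rfl (h z w)
      exact hw this
    obtain ⟨a⟩ : Nonempty α := inferInstance
    have hc : f.IsCycle := ⟨a, hne _, fun y _ => h _ y⟩
    have hs : f.support = univ := by ext z; simp [hne]
    rw [hc.cycleType, hs]
    simp
  · intro h x y
    have hc : f.IsCycle := card_cycleType_eq_one.1 (by simp [h])
    have hs : f.support = univ := by
      rw [← card_eq_iff_eq_univ, ← sum_cycleType, h]; simp
    have key : ∀ z, f z ≠ z := fun z => by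
        rw [← mem_support, hs]; exact mem_univ _
    exact hc.sameCycle (key _) (key _)

open Classical in
lemma card_isFull [Nonempty α] :
    #{f : Perm α | IsFull f} = (Fintype.card α - 1).factorial := by
  obtain h1 | h2 : Fintype.card α = 1 ∨ 2 ≤ Fintype.card α := by
    have := Fintype.card_pos (α := α); omega
  · have : Subsingleton α := Fintype.card_le_one_iff_subsingleton.1 h1.le
    have : ({f : Perm α | IsFull f} : Finset (Perm α)) = {1} := by
      ext f
      simp only [mem_filter, mem_univ, true_and, mem_singleton]
      exact ⟨fun _ => Subsingleton.elim _ _, fun _ x y => by rw [Subsingleton.elim x y]⟩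
    rw [this, h1]; simp
  · have := card_of_cycleType_singleton (α := α) h2 le_rfl
    simp only [isFull_iff_cycleType h2]
    simpa using this

lemma sign_isFull [Nonempty α] {f : Perm α} (h : IsFull f) :
    (-1) ^ Fintype.card α * ((sign f : ℤˣ) : ℤ) = -1 := by
  obtain h1 | h2 : Fintype.card α = 1 ∨ 2 ≤ Fintype.card α := by
    have := Fintype.card_pos (α := α); omega
  · have : Subsingleton α := Fintype.card_le_one_iff_subsingleton.1 h1.le
    rw [Subsingleton.elim f 1, h1]; simp
  · rw [sign_of_cycleType, (isFull_iff_cycleType h2 f).1 h]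
    simp [pow_succ, ← pow_add, ← two_mul]

end Count

lemma isFull_iff_isConj {n : ℕ} (hn : 0 < n) (f : Perm (Fin n)) :
    IsFull f ↔ IsConj (finRotate n) f := by
  obtain rfl | h2 : n = 1 ∨ 2 ≤ n := by omega
  · rw [Subsingleton.elim f (finRotate 1)]
    refine ⟨fun _ => IsConj.refl _, fun _ x y => ?_⟩
    rw [Subsingleton.elim x y]
  · rw [isFull_iff_cycleType (by simpa), isConj_iff_cycleType_eq, cycleType_finRotate_of_le h2,
      Fintype.card_fin, eq_comm]

lemma stable_iff [DecidableEq α] {f : Perm α} {A : Finset α} (h : ∀ x ∈ A, f x ∈ A) (x : α) :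
    f x ∈ A ↔ x ∈ A := by
  have : A.image f = A :=
    eq_of_subset_of_card_le (image_subset_iff.2 h) (card_image_of_injective _ f.injective).ge
  refine ⟨fun hx => ?_, h x⟩
  rw [← this, mem_image] at hx
  obtain ⟨y, hy, hxy⟩ := hx
  rwa [← f.injective hxy]

lemma exists_extension [DecidableEq α] {f : Perm α} {A : Finset α} (h : ∀ x ∈ A, f x ∈ A) :
    ∃ g : Perm α, (∀ x ∈ A, g x = f x) ∧ ∀ x ∉ A, g x = x :=
  ⟨ofSubtype (f.subtypePerm (stable_iff h)),
    fun _ hx => ofSubtype_subtypePerm_of_mem (stable_iff h) hx,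
    fun _ hx => ofSubtype_subtypePerm_of_not_mem (stable_iff h) hx⟩

section RestrictSign
variable [Fintype α] [DecidableEq α]

/-- The sign of the restriction of `f` to `A` if `A` is stable under `f`, and `0` otherwise. -/
def restrictSign (f : Perm α) (A : Finset α) : ℤ :=
  if h : ∀ x, f x ∈ A ↔ x ∈ A then sign (f.subtypePerm h) else 0

lemma restrictSign_eq_zero {f : Perm α} {A : Finset α} {x : α} (hx : x ∈ A) (hfx : f x ∉ A) :
    restrictSign f A = 0 := by
  rw [restrictSign, dif_neg]
  intro h
  exact hfx ((h x).2 hx)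

lemma restrictSign_eq_sign {f g : Perm α} {A : Finset α} (h : ∀ x ∈ A, f x ∈ A)
    (hg : ∀ x ∈ A, g x = f x) (hg' : ∀ x ∉ A, g x = x) : restrictSign f A = sign g := by
  rw [restrictSign, dif_pos (stable_iff h), ← sign_ofSubtype]
  congr 2
  ext x
  by_cases hx : x ∈ A
  · rw [ofSubtype_subtypePerm_of_mem _ hx, hg x hx]
  · rw [ofSubtype_subtypePerm_of_not_mem _ hx, hg' x hx]

lemma restrictSign_congr {f g : Perm α} {A : Finset α} (h : ∀ x ∈ A, f x = g x) :
    restrictSign f A = restrictSign g A := by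
  by_cases hf : ∀ x ∈ A, f x ∈ A
  · obtain ⟨e, he, he'⟩ := exists_extension hf
    rw [restrictSign_eq_sign hf he he', restrictSign_eq_sign (g := e) _ _ he']
    · exact fun x hx => h x hx ▸ hf x hx
    · exact fun x hx => h x hx ▸ he x hx
  · push Not at hf
    obtain ⟨x, hx, hfx⟩ := hf
    rw [restrictSign_eq_zero hx hfx, restrictSign_eq_zero hx (h x hx ▸ hfx)]

lemma restrictSign_mul {f g : Perm α} {A : Finset α} (hf : ∀ x ∈ A, f x ∈ A) :
    restrictSign (f * g) A = restrictSign f A * restrictSign g A := by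
  by_cases hg : ∀ x ∈ A, g x ∈ A
  · obtain ⟨e, he, he'⟩ := exists_extension hf
    obtain ⟨d, hd, hd'⟩ := exists_extension hg
    rw [restrictSign_eq_sign hf he he', restrictSign_eq_sign hg hd hd',
      restrictSign_eq_sign (g := e * d)]
    · simp
    · exact fun x hx => hf _ (hg x hx)
    · intro x hx
      simp [hd x hx, he _ (hg x hx)]
    · intro x hx
      simp [hd' x hx, he' x hx]
  · push Not at hg
    obtain ⟨x, hx, hgx⟩ := hg
    rw [restrictSign_eq_zero hx hgx, restrictSign_eq_zero hx, mul_zero]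
    rwa [Perm.mul_apply, stable_iff hf]

lemma restrictSign_mul_right {f g : Perm α} {A : Finset α} (hg : ∀ x ∈ A, g x ∈ A) :
    restrictSign (f * g) A = restrictSign f A * restrictSign g A := by
  by_cases hf : ∀ x ∈ A, f x ∈ A
  · exact restrictSign_mul hf
  · push Not at hf
    obtain ⟨x, hx, hfx⟩ := hf
    rw [restrictSign_eq_zero hx hfx, zero_mul]
    refine restrictSign_eq_zero (x := g⁻¹ x) ?_ (by simpa using hfx)
    rw [← stable_iff hg]; simpa using hx

lemma restrictSign_union {f : Perm α} {A C : Finset α} (hC : ∀ x ∈ C, f x ∈ C)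
    (hd : Disjoint A C) : restrictSign f (A ∪ C) = restrictSign f A * restrictSign f C := by
  by_cases hA : ∀ x ∈ A, f x ∈ A
  · obtain ⟨e, he, he'⟩ := exists_extension hA
    obtain ⟨d, hd₁, hd'⟩ := exists_extension hC
    rw [restrictSign_eq_sign hA he he', restrictSign_eq_sign hC hd₁ hd',
      restrictSign_eq_sign (g := e * d)]
    · simp
    · intro x hx
      rcases mem_union.1 hx with h | h
      · exact mem_union_left _ (hA x h)
      · exact mem_union_right _ (hC x h)
    · intro x hx
      rcases mem_union.1 hx with h | h
      · rw [Perm.mul_apply, hd' x (disjoint_left.1 hd h), he x h]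
      · rw [Perm.mul_apply, hd₁ x h, he' _ (disjoint_right.1 hd (hC x h))]
    · intro x hx
      rw [mem_union, not_or] at hx
      rw [Perm.mul_apply, hd' x hx.2, he' x hx.1]
  · push Not at hA
    obtain ⟨x, hx, hfx⟩ := hA
    rw [restrictSign_eq_zero hx hfx, zero_mul]
    refine restrictSign_eq_zero (mem_union_left _ hx) ?_
    rw [mem_union, not_or]
    refine ⟨hfx, fun h => disjoint_left.1 hd hx ((stable_iff hC x).1 h)⟩

@[simp]
lemma restrictSign_empty (f : Perm α) : restrictSign f ∅ = 1 := by
  rw [restrictSign_eq_sign (g := 1)] <;> simp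

lemma restrictSign_singleton {f : Perm α} {x : α} (h : f x = x) : restrictSign f {x} = 1 := by
  rw [restrictSign_eq_sign (g := 1)] <;> simp [h]

lemma restrictSign_swap {A : Finset α} {x y : α} (hx : x ∈ A) (hy : y ∈ A) (hxy : x ≠ y) :
    restrictSign (swap x y) A = -1 := by
  rw [restrictSign_eq_sign (g := swap x y)]
  · simp [sign_swap hxy]
  · intro z hz
    by_cases h1 : z = x
    · subst h1; simpa
    by_cases h2 : z = y
    · subst h2; simpa
    rwa [swap_apply_of_ne_of_ne h1 h2]
  · simp
  · intro z hz
    exact swap_apply_of_ne_of_ne (by rintro rfl; exact hz hx) (by rintro rfl; exact hz hy)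

lemma restrictSign_cycle {f : Perm α} {C : Finset α} {x : α} (hx : x ∈ C)
    (hC : ∀ w ∈ C, f w ∈ C) (hC' : ∀ w ∈ C, f.SameCycle x w) :
    (-1) ^ #C * restrictSign f C = -1 := by
  rw [restrictSign, dif_pos (stable_iff hC)]
  have : Nonempty C := ⟨⟨x, hx⟩⟩
  rw [← Fintype.card_coe C]
  apply sign_isFull
  intro y z
  rw [sameCycle_subtypePerm]
  exact (hC' _ y.2).symm.trans (hC' _ z.2)

/-- A signed sum over stable sets avoiding `z` detects full cycles. -/
lemma sum_restrictSign [DecidablePred (IsFull : Perm α → Prop)] (f : Perm α) (z : α) :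
    ∑ A : Finset α with z ∉ A, (-1) ^ #A * restrictSign f A = if IsFull f then 1 else 0 := by
  classical
  split_ifs with hf
  · rw [sum_eq_single ∅]
    · simp
    · intro A hA hne
      obtain ⟨x, hx⟩ := nonempty_iff_ne_empty.2 hne
      have hz := (mem_filter.1 hA).2
      by_cases h : ∀ x ∈ A, f x ∈ A
      · exact absurd (mem_of_sameCycle (S := (A : Set α)) h hx (hf x z)) hz
      · push Not at h
        obtain ⟨y, hy, hy'⟩ := h
        rw [restrictSign_eq_zero hy hy', mul_zero]
    · simp
  · obtain ⟨w, hw⟩ : ∃ w, ¬ f.SameCycle z w := by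
      by_contra! h
      exact hf fun x y => (h x).symm.trans (h y)
    set C : Finset α := {y | f.SameCycle w y} with hCdef
    have hC : ∀ x ∈ C, f x ∈ C := by intro x hx; simpa [hCdef] using hx
    have hCs := restrictSign_cycle (f := f) (C := C) (x := w) (by simp [hCdef, SameCycle.refl]) hC
      (by intro y hy; simpa [hCdef] using hy)
    have hzC : z ∉ C := by simpa [hCdef] using fun h => hw (SameCycle.symm h)
    have key : ∀ A, Disjoint A C → (-1) ^ #A * restrictSign f A
        + (-1) ^ #(A ∪ C) * restrictSign f (A ∪ C) = 0 := by
      intro A hA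
      rw [restrictSign_union hC hA, card_union_of_disjoint hA, pow_add]
      linear_combination ((-1) ^ #A * restrictSign f A) * hCs
    have hsplit : ∀ A : Finset α, ¬ Disjoint A C → ¬ C ⊆ A → restrictSign f A = 0 := by
      intro A h1 h2
      by_contra hne
      have hst : ∀ x ∈ A, f x ∈ A := by
        intro x hx; by_contra h
        exact hne (restrictSign_eq_zero hx h)
      obtain ⟨a, haA, haC⟩ := not_disjoint_iff.1 h1
      refine h2 fun b hb => mem_of_sameCycle (S := (A : Set α)) hst haA ?_
      simp only [hCdef, mem_filter, mem_univ, true_and] at haC hb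
      exact haC.symm.trans hb
    have hmem : ∀ A : Finset α, ∀ x ∈ C, x ∈ symmDiff A C ↔ x ∉ A := by
      intro A x hx
      simp [mem_symmDiff, hx]
    refine sum_involution (g := fun A _ => symmDiff A C) ?_ ?_ ?_ ?_
    · intro A _
      by_cases h : Disjoint A C
      · rw [h.symmDiff_eq_sup]
        exact key A h
      by_cases h2 : C ⊆ A
      · have := key (A \ C) sdiff_disjoint
        rw [sdiff_union_of_subset h2] at this
        rw [symmDiff_of_ge h2, add_comm]; exact this
      · rw [hsplit A h h2, hsplit (symmDiff A C)]
        · simp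
        · obtain ⟨x, hx, hxA⟩ := not_subset.1 h2
          exact not_disjoint_iff.2 ⟨x, (hmem A x hx).2 hxA, hx⟩
        · obtain ⟨x, hxA, hx⟩ := not_disjoint_iff.1 h
          exact fun hs => (hmem A x hx).1 (hs hx) hxA
    · intro A _ _ h
      have hw' : w ∈ C := by simp [hCdef, SameCycle.refl]
      have := hmem A w hw'
      rw [h] at this
      tauto
    · intro A hA
      simp_all [mem_symmDiff]
    · intro A _
      exact symmDiff_symmDiff_cancel_right _ _

end RestrictSign
section Gluing
variable [Fintype α] [DecidableEq α]

lemma isFull_swap_mul_iff {v : Perm α} {A : Finset α} {x y : α} (hx : x ∈ A) (hy : y ∉ A)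
    (hv : ∀ a ∈ A, v a ∈ A) :
    IsFull (swap x y * v) ↔ (∀ a ∈ A, v.SameCycle x a) ∧ ∀ a ∉ A, v.SameCycle y a := by
  have hxy : x ≠ y := by rintro rfl; exact hy hx
  have hvA : ∀ {a b}, v.SameCycle a b → (a ∈ A ↔ b ∈ A) := fun {a b} h =>
    ⟨fun ha => mem_of_sameCycle (S := (A : Set α)) hv ha h,
      fun hb => mem_of_sameCycle (S := (A : Set α)) hv hb h.symm⟩
  constructor
  · intro hu
    have key : ∀ w, v.SameCycle x w ∨ v.SameCycle y w := by
      intro w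
      by_contra! h
      have := mem_of_sameCycle (f := swap x y * v) (S := {c | v.SameCycle w c}) ?_
        (SameCycle.refl v w) (hu w x)
      · exact h.1 this.symm
      · intro c hc
        have hc' : v.SameCycle w (v c) := by simpa using hc
        rw [Perm.mul_apply, swap_apply_of_ne_of_ne]
        · exact hc'
        · intro e; exact h.1 (e ▸ hc').symm
        · intro e; exact h.2 (e ▸ hc').symm
    refine ⟨fun a ha => (key a).resolve_right fun h => hy ((hvA h).2 ha),
      fun a ha => (key a).resolve_left fun h => ha ((hvA h).1 hx)⟩
  · rintro ⟨h1, h2⟩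
    set u := swap x y * v with hu
    have hux : ∀ c, v c = x → u c = y := fun c h => by simp [hu, h]
    have huo : ∀ c, v c ≠ x → v c ≠ y → u c = v c := fun c h h' => by
      rw [hu, Perm.mul_apply, swap_apply_of_ne_of_ne h h']
    have hxyc : u.SameCycle x y := by
      by_contra hn
      have hst : ∀ c ∈ {c | c ∈ A ∧ u.SameCycle x c}, v c ∈ {c | c ∈ A ∧ u.SameCycle x c} := by
        rintro c ⟨hc, hc'⟩
        refine ⟨hv c hc, ?_⟩
        have hcu : u.SameCycle x (u c) := by simpa using hc'
        rw [← huo c]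
        · exact hcu
        · intro h
          rw [hux c h] at hcu
          exact hn hcu
        · rintro h
          exact hy (h ▸ hv c hc)
      have hm := mem_of_sameCycle hst ⟨hx, SameCycle.refl u x⟩
        (h1 (v⁻¹ x) (by rw [← stable_iff hv]; simpa using hx))
      have := hm.2
      rw [← sameCycle_apply_right, hux _ (by simp)] at this
      exact hn this
    have key : ∀ w, u.SameCycle x w := by
      intro w
      by_contra hn
      have hst : ∀ c ∈ {c | u.SameCycle w c}, v c ∈ {c | u.SameCycle w c} := by
        intro c hc
        have hcu : u.SameCycle w (u c) := by simpa using hc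
        show u.SameCycle w (v c)
        rw [← huo c]
        · exact hcu
        · intro h
          rw [hux c h] at hcu
          exact hn (hxyc.trans hcu.symm)
        · intro h
          rw [hu, Perm.mul_apply, h, swap_apply_right] at hcu
          exact hn hcu.symm
      by_cases hw : w ∈ A
      · exact hn (mem_of_sameCycle hst (SameCycle.refl u w) (h1 w hw).symm).symm
      · have h3 : u.SameCycle w y :=
          mem_of_sameCycle hst (SameCycle.refl u w) (h2 w hw).symm
        exact hn (hxyc.trans h3.symm)
    exact fun a b => (key a).symm.trans (key b)

open Classical in
lemma card_two_cycles {A : Finset α} {x y : α} (hx : x ∈ A) (hy : y ∉ A) :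
    #{v : Perm α | (∀ a ∈ A, v a ∈ A) ∧ (∀ a ∈ A, v.SameCycle x a) ∧ ∀ a ∉ A, v.SameCycle y a}
      = (#A - 1).factorial * (Fintype.card α - #A - 1).factorial := by
  have : Nonempty {a // a ∈ A} := ⟨⟨x, hx⟩⟩
  have : Nonempty {a // a ∉ A} := ⟨⟨y, hy⟩⟩
  have e1 := card_isFull (α := {a // a ∈ A})
  have e2 := card_isFull (α := {a // a ∉ A})
  rw [Fintype.card_coe] at e1
  rw [Fintype.card_subtype_compl, Fintype.card_coe] at e2
  rw [← e1, ← e2, ← card_product]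
  symm
  refine card_bij (fun p _ => Perm.subtypeCongr p.1 p.2) ?_ ?_ ?_
  · rintro ⟨f, g⟩ h
    simp only [mem_product, mem_filter, mem_univ, true_and] at h ⊢
    have hst : ∀ a ∈ A, Perm.subtypeCongr f g a ∈ A := fun a ha => by
      rw [Perm.subtypeCongr.left_apply _ _ ha]; exact (f ⟨a, ha⟩).2
    have hst' : ∀ a, Perm.subtypeCongr f g a ∉ A ↔ a ∉ A := fun a => by rw [stable_iff hst]
    have hf : (Perm.subtypeCongr f g).subtypePerm (stable_iff hst) = f := by
      ext a; simp
    have hg : (Perm.subtypeCongr f g).subtypePerm hst' = g := by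
      ext a; simp
    refine ⟨hst, fun a ha => ?_, fun a ha => ?_⟩
    · have := h.1 ⟨x, hx⟩ ⟨a, ha⟩
      rwa [← hf, sameCycle_subtypePerm] at this
    · have := h.2 ⟨y, hy⟩ ⟨a, ha⟩
      rwa [← hg, sameCycle_subtypePerm] at this
  · rintro ⟨f, g⟩ _ ⟨f', g'⟩ _ h
    exact subtypeCongrHom_injective (· ∈ A) h
  · intro v hv
    simp only [mem_filter, mem_univ, true_and] at hv
    obtain ⟨hst, h1, h2⟩ := hv
    have hst' : ∀ a, v a ∉ A ↔ a ∉ A := fun a => by rw [stable_iff hst]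
    refine ⟨(v.subtypePerm (stable_iff hst), v.subtypePerm hst'), ?_, ?_⟩
    · simp only [mem_product, mem_filter, mem_univ, true_and]
      refine ⟨fun a b => ?_, fun a b => ?_⟩
      · rw [sameCycle_subtypePerm]
        exact (h1 _ a.2).symm.trans (h1 _ b.2)
      · rw [sameCycle_subtypePerm]
        exact (h2 _ a.2).symm.trans (h2 _ b.2)
    · ext a
      by_cases ha : a ∈ A
      · rw [Perm.subtypeCongr.left_apply _ _ ha]; rfl
      · rw [Perm.subtypeCongr.right_apply _ _ ha]; rfl

open Classical in
lemma card_isFull_swap_stable {A : Finset α} {x y : α} (hx : x ∈ A) (hy : y ∉ A) :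
    #{u : Perm α | IsFull u ∧ ∀ a ∈ A, (swap x y * u) a ∈ A}
      = (#A - 1).factorial * (Fintype.card α - #A - 1).factorial := by
  rw [← card_two_cycles hx hy]
  refine card_bij (fun u _ => swap x y * u) ?_ ?_ ?_
  · intro u hu
    simp only [mem_filter, mem_univ, true_and] at hu ⊢
    refine ⟨hu.2, (isFull_swap_mul_iff hx hy hu.2).1 ?_⟩
    rw [← mul_assoc, swap_mul_self, one_mul]; exact hu.1
  · intro u _ u' _ h
    exact mul_left_cancel h
  · intro v hv
    simp only [mem_filter, mem_univ, true_and] at hv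
    refine ⟨swap x y * v, ?_, by rw [← mul_assoc, swap_mul_self, one_mul]⟩
    simp only [mem_filter, mem_univ, true_and]
    refine ⟨(isFull_swap_mul_iff hx hy hv.1).2 hv.2, ?_⟩
    rw [← mul_assoc, swap_mul_self, one_mul]; exact hv.1

variable {D : Perm α}

open Classical in
lemma sum_restrictSign_of_unique (hD : ∀ x, D (D x) = x) {A : Finset α} {x : α} (hx : x ∈ A)
    (hDx : D x ∉ A) (hA : ∀ a ∈ A, a ≠ x → D a ∈ A) :
    ∑ u : Perm α with IsFull u, restrictSign (D * u) A
      = (-1) ^ (#A - 1) * restrictSign D (A.erase x) *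
        ((#A - 1).factorial * (Fintype.card α - #A - 1).factorial : ℕ) := by
  have hxD : x ≠ D x := fun h => hDx (h ▸ hx)
  have hB : ∀ a ∈ A.erase x, D a ∈ A.erase x := by
    intro a ha
    rw [mem_erase] at ha ⊢
    refine ⟨fun h => hDx ?_, hA a ha.2 ha.1⟩
    rw [← h, hD]; exact ha.2
  have hEB : ∀ a ∈ A.erase x, (D * swap x (D x)) a = D a := by
    intro a ha
    rw [Perm.mul_apply, swap_apply_of_ne_of_ne (ne_of_mem_erase ha)]
    rintro rfl
    exact hDx (mem_of_mem_erase ha)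
  have hEx : (D * swap x (D x)) x = x := by simp [hD]
  have hE : ∀ a ∈ A, (D * swap x (D x)) a ∈ A := by
    intro a ha
    by_cases h : a = x
    · rw [h, hEx]; exact hx
    · rw [hEB a (mem_erase.2 ⟨h, ha⟩)]; exact hA a ha h
  have hrsE : restrictSign (D * swap x (D x)) A = restrictSign D (A.erase x) := by
    have : A = A.erase x ∪ {x} := by
      rw [union_comm, ← insert_eq, insert_erase hx]
    rw [this, restrictSign_union (by simpa using hEx) (by simp), restrictSign_singleton hEx,
      mul_one, ← this, restrictSign_congr hEB]
  have hfac : ∀ u, restrictSign (D * u) A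
      = restrictSign D (A.erase x) * restrictSign (swap x (D x) * u) A := by
    intro u
    rw [← hrsE, ← restrictSign_mul hE]
    congr 1
    rw [mul_assoc, ← mul_assoc (swap x (D x)), swap_mul_self, one_mul]
  have hval : ∀ u, IsFull u → restrictSign (swap x (D x) * u) A
      = if (∀ a ∈ A, (swap x (D x) * u) a ∈ A) then (-1) ^ (#A - 1) else 0 := by
    intro u hu
    split_ifs with h
    · have hc := (isFull_swap_mul_iff hx hDx h).1
        (by rw [← mul_assoc, swap_mul_self, one_mul]; exact hu)
      have h3 := restrictSign_cycle hx h hc.1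
      obtain ⟨k, hk⟩ : ∃ k, #A = k + 1 := Nat.exists_eq_succ_of_ne_zero (card_ne_zero_of_mem hx)
      rw [hk] at h3 ⊢
      have h4 : ((-1 : ℤ) ^ k) * (-1) ^ k = 1 := by rw [← mul_pow]; simp
      simp only [Nat.add_sub_cancel]
      rw [pow_succ] at h3
      linear_combination (-(-1) ^ k) * h3 - restrictSign (swap x (D x) * u) A * h4
    · push Not at h
      obtain ⟨a, ha, ha'⟩ := h
      exact restrictSign_eq_zero ha ha'
  rw [sum_congr rfl fun u _ => hfac u, ← mul_sum,
    sum_congr rfl fun u hu => hval u (mem_filter.1 hu).2, ← sum_filter, filter_filter, sum_const,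
    card_isFull_swap_stable hx hDx, nsmul_eq_mul]
  ring

open Classical in
lemma sum_restrictSign_of_two (hD : ∀ x, D (D x) = x) {A : Finset α} {x y : α} (hx : x ∈ A)
    (hDx : D x ∉ A) (hy : y ∈ A) (hDy : D y ∉ A) (hxy : x ≠ y) :
    ∑ u : Perm α with IsFull u, restrictSign (D * u) A = 0 := by
  have hsw : ∀ a ∈ A, swap x y a ∈ A := by
    intro z hz
    by_cases h1 : z = x
    · subst h1; simpa
    by_cases h2 : z = y
    · subst h2; simpa
    rwa [swap_apply_of_ne_of_ne h1 h2]
  have hflip : ∀ u, restrictSign (D * (swap x y * u * swap x y)) A = - restrictSign (D * u) A := by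
    intro u
    rw [← mul_assoc, restrictSign_mul_right hsw, restrictSign_swap hx hy hxy, ← mul_assoc, mul_neg,
      mul_one, neg_inj]
    have h1 : D * swap x y * u = (D * swap x y * D⁻¹) * (D * u) := by group
    have h2 : ∀ a ∈ A, (D * swap x y * D⁻¹) a = a := by
      intro a ha
      have hDi : D⁻¹ a = D a := by rw [Perm.inv_eq_iff_eq, hD]
      rw [Perm.mul_apply, Perm.mul_apply, hDi, swap_apply_of_ne_of_ne, hD]
      · rintro rfl; rw [hD] at hDx; exact hDx ha
      · rintro rfl; rw [hD] at hDy; exact hDy ha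
    rw [h1, restrictSign_mul (fun a ha => (h2 a ha).symm ▸ ha),
      restrictSign_eq_sign (g := 1) (fun a ha => (h2 a ha).symm ▸ ha)
      (fun a ha => (h2 a ha).symm) (fun _ _ => rfl)]
    simp
  have hsum : ∑ u : Perm α with IsFull u, restrictSign (D * u) A
      = ∑ u : Perm α with IsFull u, restrictSign (D * (swap x y * u * swap x y)) A := by
    have hfull : ∀ u, IsFull u → IsFull (swap x y * u * swap x y) := by
      intro u hu a b
      have := sameCycle_conj (f := u) (g := swap x y) (x := a) (y := b)
      rw [swap_inv] at this
      exact this.2 (hu _ _)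
    have hinv : ∀ u, swap x y * (swap x y * u * swap x y) * swap x y = u := by
      intro u
      rw [mul_assoc, mul_assoc, swap_mul_self, mul_one, ← mul_assoc, swap_mul_self, one_mul]
    refine sum_nbij' (fun u => swap x y * u * swap x y) (fun u => swap x y * u * swap x y)
      ?_ ?_ ?_ ?_ ?_
    · intro u hu; simpa using hfull u (mem_filter.1 hu).2
    · intro u hu; simpa using hfull u (mem_filter.1 hu).2
    · intro u _; exact hinv u
    · intro u _; exact hinv u
    · intro u _; rw [hinv]
  simp only [hflip, sum_neg_distrib] at hsum
  omega

open Classical in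
lemma sum_restrictSign_of_stable {A : Finset α} (hA : ∀ a ∈ A, D a ∈ A) (hne : A.Nonempty) {z : α}
    (hz : z ∉ A) : ∑ u : Perm α with IsFull u, restrictSign (D * u) A = 0 := by
  refine sum_eq_zero fun u hu => ?_
  obtain ⟨x, hx⟩ := hne
  rw [restrictSign_mul hA]
  by_cases h : ∀ a ∈ A, u a ∈ A
  · exact absurd (mem_of_sameCycle (S := (A : Set α)) h hx ((mem_filter.1 hu).2 x z)) hz
  · push Not at h
    obtain ⟨a, ha, ha'⟩ := h
    rw [restrictSign_eq_zero ha ha', mul_zero]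

open Classical in
lemma sum_restrictSign_mul (hD : ∀ x, D (D x) = x) {A : Finset α} (hne : A.Nonempty) {z : α}
    (hz : z ∉ A) :
    ∑ u : Perm α with IsFull u, restrictSign (D * u) A
      = ∑ x ∈ A with D x ∉ A, (-1) ^ (#A - 1) * restrictSign D (A.erase x) *
        ((#A - 1).factorial * (Fintype.card α - #A - 1).factorial : ℕ) := by
  by_cases h0 : ∀ a ∈ A, D a ∈ A
  · rw [sum_restrictSign_of_stable h0 hne hz, filter_false_of_mem, sum_empty]
    simpa using h0
  push Not at h0
  obtain ⟨x, hx, hDx⟩ := h0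
  by_cases h1 : ∀ a ∈ A, a ≠ x → D a ∈ A
  · rw [sum_restrictSign_of_unique hD hx hDx h1]
    rw [sum_eq_single x]
    · intro b hb hbx
      exact absurd (h1 b (mem_filter.1 hb).1 hbx) (mem_filter.1 hb).2
    · intro h; exact absurd (mem_filter.2 ⟨hx, hDx⟩) h
  push Not at h1
  obtain ⟨y, hy, hyx, hDy⟩ := h1
  rw [sum_restrictSign_of_two hD hx hDx hy hDy hyx.symm, sum_eq_zero]
  have aux : ∀ b c, c ∈ A → D c ∉ A → c ≠ b → restrictSign D (A.erase b) = 0 := by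
    intro b c hc hDc hcb
    exact restrictSign_eq_zero (mem_erase.2 ⟨hcb, hc⟩) fun h => hDc (mem_of_mem_erase h)
  intro b _
  by_cases hbx : x = b
  · rw [aux b y hy hDy (hbx ▸ hyx)]; simp
  · rw [aux b x hx hDx hbx]; simp

end Gluing
section Involution
variable [Fintype α] [DecidableEq α] {D : Perm α}

open Classical in
lemma card_isFull_mul (hD : ∀ x, D (D x) = x) (z : α) :
    (#{u : Perm α | IsFull u ∧ IsFull (D * u)} : ℤ)
      = (Fintype.card α - 1).factorial - ∑ x with x ≠ z ∧ D x ≠ x,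
          ∑ B ∈ ({x, D x, z, D z} : Finset α)ᶜ.powerset,
            restrictSign D B * ((#B).factorial * (Fintype.card α - 2 - #B).factorial : ℕ) := by
  have : Nonempty α := ⟨z⟩
  set G : Finset α → ℤ := fun B =>
    restrictSign D B * ((#B).factorial * (Fintype.card α - 2 - #B).factorial : ℕ) with hG
  have h1 : (#{u : Perm α | IsFull u ∧ IsFull (D * u)} : ℤ)
      = ∑ A : Finset α with z ∉ A, (-1) ^ #A *
          ∑ u : Perm α with IsFull u, restrictSign (D * u) A := by
    rw [← filter_filter, card_filter]
    push_cast
    simp only [← sum_restrictSign _ z]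
    rw [sum_comm]
    simp only [mul_sum]
  have h2 : ∀ A : Finset α, A.Nonempty → z ∉ A → (-1) ^ #A *
      ∑ u : Perm α with IsFull u, restrictSign (D * u) A
        = - ∑ x ∈ A with D x ∉ A, G (A.erase x) := by
    intro A hne hz
    rw [sum_restrictSign_mul hD hne hz, mul_sum, ← sum_neg_distrib]
    refine sum_congr rfl fun x hx => ?_
    obtain ⟨k, hk⟩ : ∃ k, #A = k + 1 := Nat.exists_eq_succ_of_ne_zero hne.card_pos.ne'
    have h4 : ((-1 : ℤ) ^ k) * (-1) ^ k = 1 := by rw [← mul_pow]; simp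
    simp only [hG, card_erase_of_mem (mem_filter.1 hx).1, hk, Nat.add_sub_cancel]
    rw [show Fintype.card α - (k + 1) - 1 = Fintype.card α - 2 - k by omega, pow_succ]
    linear_combination (-restrictSign D (A.erase x) *
      (k.factorial * (Fintype.card α - 2 - k).factorial : ℕ)) * h4
  have h3 : (univ.filter fun A : Finset α => z ∉ A)
      = insert ∅ (univ.filter fun A : Finset α => z ∉ A ∧ A.Nonempty) := by
    ext A
    rcases A.eq_empty_or_nonempty with rfl | h
    · simp
    · simp [h, h.ne_empty]
  have h4 : ∀ x, x ≠ z → ∑ B ∈ ({x, D x, z, D z} : Finset α)ᶜ.powerset, G B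
      = ∑ B ∈ ({x, D x, z} : Finset α)ᶜ.powerset, G B := by
    intro x hx
    refine sum_subset (powerset_mono.2 (compl_subset_compl.2 ?_)) ?_
    · intro w; simp only [mem_insert, mem_singleton]; tauto
    · intro B hB hB'
      rw [mem_powerset, subset_compl_comm] at hB hB'
      have hz : z ∉ B := by
        have := hB (x := z) (by simp)
        simpa using this
      have hDz : D z ∈ B := by
        by_contra h
        apply hB'
        intro w hw
        by_cases hwz : w = D z
        · subst hwz; simpa using h
        · refine hB ?_
          simp only [mem_insert, mem_singleton] at hw ⊢
          tauto
      simp only [hG]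
      rw [restrictSign_eq_zero hDz (by rwa [hD]), zero_mul]
  rw [h1, h3, sum_insert (by simp), sum_congr rfl
    fun A hA => h2 A (mem_filter.1 hA).2.2 (mem_filter.1 hA).2.1, sum_neg_distrib, ← sub_eq_add_neg]
  congr 1
  · simp [card_isFull]
  · rw [sum_congr rfl fun x hx => h4 x (mem_filter.1 hx).2.1, sum_sigma', sum_sigma']
    refine sum_bij' (fun p _ => ⟨p.2, p.1.erase p.2⟩) (fun p _ => ⟨insert p.1 p.2, p.1⟩)
      ?_ ?_ ?_ ?_ ?_
    · rintro ⟨A, x⟩ h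
      simp only [mem_sigma, mem_filter, mem_univ, true_and, mem_powerset] at h ⊢
      obtain ⟨⟨hz, -⟩, hx, hDx⟩ := h
      refine ⟨⟨fun h => hz (h ▸ hx), fun h => hDx (h.symm ▸ hx)⟩, ?_⟩
      intro w hw
      rw [mem_erase] at hw
      simp only [mem_compl, mem_insert, mem_singleton, not_or]
      exact ⟨hw.1, fun h => hDx (h ▸ hw.2), fun h => hz (h ▸ hw.2)⟩
    · rintro ⟨x, B⟩ h
      simp only [mem_sigma, mem_filter, mem_univ, true_and, mem_powerset] at h ⊢
      obtain ⟨⟨hxz, hDx⟩, hB⟩ := h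
      rw [subset_compl_comm] at hB
      have hz := hB (x := z) (by simp)
      have hx := hB (x := D x) (by simp)
      rw [mem_compl] at hz hx
      simp [hz, hx, hDx, Ne.symm hxz]
    · rintro ⟨A, x⟩ h
      simp only [mem_sigma, mem_filter, mem_univ, true_and] at h
      simp [insert_erase h.2.1]
    · rintro ⟨x, B⟩ h
      simp only [mem_sigma, mem_filter, mem_univ, true_and, mem_powerset] at h
      have hx := (subset_compl_comm.1 h.2) (x := x) (by simp)
      rw [mem_compl] at hx
      simp [erase_insert hx]
    · rintro ⟨A, x⟩ _
      rfl

lemma sum_powerset_restrictSign (hD : ∀ x, D (D x) = x) {p q : ℝ} (hpq : p + q = 1)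
    (W : Finset α) : ∀ r, (∀ w ∈ W, D w ∈ W) → #{w ∈ W | D w ≠ w} = 2 * r →
      ∑ B ∈ W.powerset, (restrictSign D B : ℝ) * (p ^ #B * q ^ (#W - #B)) = (q - p) ^ r := by
  induction W using Finset.strongInduction with
  | H W ih =>
    intro r hW hr
    rcases W.eq_empty_or_nonempty with rfl | ⟨w, hw⟩
    · have : r = 0 := by simpa using hr
      simp [this]
    have hle : ∀ {V B : Finset α}, B ∈ V.powerset → #B ≤ #V := fun h =>
      card_le_card (mem_powerset.1 h)
    by_cases hDw : D w = w
    · set V := W.erase w with hV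
      have hVW : insert w V = W := insert_erase hw
      have hwV : w ∉ V := notMem_erase _ _
      have hVst : ∀ a ∈ V, D a ∈ V := by
        intro a ha
        rw [hV, mem_erase] at ha ⊢
        refine ⟨fun h => ha.1 ?_, hW a ha.2⟩
        rw [← hD a, h, hDw]
      have hVr : #{w ∈ V | D w ≠ w} = 2 * r := by
        rw [← hr, ← hVW, filter_insert, if_neg (by simpa using hDw)]
      rw [← ih V (erase_ssubset hw) r hVst hVr, ← hVW, sum_powerset_insert hwV,
        ← sum_add_distrib]
      refine sum_congr rfl fun B hB => ?_
      have hwB : w ∉ B := fun h => hwV (mem_powerset.1 hB h)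
      have h1 : restrictSign D (insert w B) = restrictSign D B := by
        rw [insert_eq, union_comm, restrictSign_union (by simpa using hDw) (by simpa using hwB),
          restrictSign_singleton hDw, mul_one]
      rw [h1, card_insert_of_notMem hwB, card_insert_of_notMem hwV, Nat.add_sub_add_right,
        Nat.sub_add_comm (hle hB), pow_succ, pow_succ]
      linear_combination ((restrictSign D B : ℝ) * (p ^ #B * q ^ (#V - #B))) * hpq
    · set V := (W.erase w).erase (D w) with hV
      have hDwW : D w ∈ W.erase w := mem_erase.2 ⟨hDw, hW w hw⟩
      have hVW : insert w (insert (D w) V) = W := by rw [insert_erase hDwW, insert_erase hw]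
      have hDwV : D w ∉ V := notMem_erase _ _
      have hwV : w ∉ insert (D w) V := by rw [insert_erase hDwW]; exact notMem_erase _ _
      have hwV' : w ∉ V := fun h => hwV (mem_insert_of_mem h)
      have hVst : ∀ a ∈ V, D a ∈ V := by
        intro a ha
        simp only [hV, mem_erase] at ha ⊢
        refine ⟨fun h => ha.2.1 (D.injective h), fun h => ha.1 ?_, hW a ha.2.2⟩
        rw [← h, hD]
      obtain ⟨s, rfl⟩ : ∃ s, r = s + 1 := by
        refine Nat.exists_eq_succ_of_ne_zero ?_
        rintro rfl
        rw [mul_zero, card_eq_zero, filter_eq_empty_iff] at hr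
        exact hr hw hDw
      have hVr : #{w ∈ V | D w ≠ w} = 2 * s := by
        rw [← hVW, filter_insert, if_pos hDw, filter_insert, if_pos (by rw [hD]; exact Ne.symm hDw),
          card_insert_of_notMem, card_insert_of_notMem] at hr
        · omega
        · simp [hDwV]
        · rw [mem_insert, mem_filter, not_or]
          exact ⟨Ne.symm hDw, fun h => hwV' h.1⟩
      have hss : V ⊂ W := (erase_ssubset hDwW).trans (erase_ssubset hw)
      rw [pow_succ, ← ih V hss s hVst hVr, ← hVW, sum_powerset_insert hwV,
        sum_powerset_insert hDwV, sum_powerset_insert hDwV, ← sum_add_distrib, ← sum_add_distrib,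
        ← sum_add_distrib, sum_mul]
      refine sum_congr rfl fun B hB => ?_
      have hDwB : D w ∉ B := fun h => hDwV (mem_powerset.1 hB h)
      have hwB : w ∉ insert (D w) B := fun h =>
        hwV (insert_subset_insert _ (mem_powerset.1 hB) h)
      have hwB' : w ∉ B := fun h => hwB (mem_insert_of_mem h)
      have hpair : restrictSign D {w, D w} = -1 := by
        rw [restrictSign_congr (g := swap w (D w)), restrictSign_swap _ _ (Ne.symm hDw)] <;>
          simp [hD]
      have h1 : restrictSign D (insert w (insert (D w) B)) = - restrictSign D B := by
        rw [show insert w (insert (D w) B) = B ∪ {w, D w} by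
          ext a; simp only [mem_insert, mem_union, mem_singleton]; tauto,
          restrictSign_union (by simp [hD]) (by simp [hwB', hDwB]), hpair, mul_neg_one]
      have h2 : restrictSign D (insert w B) = 0 :=
        restrictSign_eq_zero (mem_insert_self _ _) (by simp [hDw, hDwB])
      have h3 : restrictSign D (insert (D w) B) = 0 :=
        restrictSign_eq_zero (mem_insert_self _ _) (by rwa [hD])
      have hexp : #V + 1 + 1 - #B = #V - #B + 2 := by have := hle hB; omega
      rw [h1, h2, h3, card_insert_of_notMem hwB, card_insert_of_notMem hDwB,
        card_insert_of_notMem hwV, card_insert_of_notMem hDwV, Nat.add_sub_add_right,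
        Nat.add_sub_add_right, hexp, pow_succ, pow_succ]
      push_cast
      linear_combination ((restrictSign D B : ℝ) * (p ^ #B * q ^ (#V - #B))) * (q - p) * hpq

end Involution

section Integral
open intervalIntegral

lemma integral_pow_mul_one_sub_pow (j : ℕ) : ∀ i : ℕ,
    ((i + j + 1).factorial : ℝ) * ∫ t in (0 : ℝ)..1, t ^ i * (1 - t) ^ j
      = i.factorial * j.factorial := by
  induction j with
  | zero =>
    intro i
    have : (i : ℝ) + 1 ≠ 0 := by positivity
    simp [integral_pow, Nat.factorial_succ]
    field_simp
  | succ j ih =>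
    intro i
    have hd : ∀ t ∈ Set.uIcc (0 : ℝ) 1, HasDerivAt (fun t : ℝ => t ^ (i + 1) * (1 - t) ^ (j + 1))
        ((i + 1) * (t ^ i * (1 - t) ^ (j + 1)) - (j + 1) * (t ^ (i + 1) * (1 - t) ^ j)) t := by
      intro t _
      have h1 := (hasDerivAt_id t).pow (i + 1)
      have h2 := ((hasDerivAt_id t).const_sub 1).pow (j + 1)
      convert! h1.mul h2 using 1
      simp
      ring
    have h := integral_eq_sub_of_hasDerivAt hd (Continuous.intervalIntegrable (by fun_prop) _ _)
    rw [integral_sub (Continuous.intervalIntegrable (by fun_prop) _ _)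
      (Continuous.intervalIntegrable (by fun_prop) _ _), integral_const_mul,
      integral_const_mul] at h
    simp only [one_pow, sub_self, zero_pow (Nat.succ_ne_zero _), mul_zero, zero_mul] at h
    have h3 := ih (i + 1)
    rw [show i + 1 + j + 1 = i + (j + 1) + 1 by ring] at h3
    have h4 : (i : ℝ) + 1 ≠ 0 := by positivity
    apply mul_left_cancel₀ h4
    rw [Nat.factorial_succ i] at h3
    rw [Nat.factorial_succ j]
    push_cast at h3 ⊢
    linear_combination (((i + (j + 1) + 1).factorial : ℕ) : ℝ) * h + ((j : ℝ) + 1) * h3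

lemma integral_final (m : ℕ) :
    ∫ t in (0 : ℝ)..1, ((1 - 2 * t) ^ (2 * m + 1)
        + (4 * m + 2) * ((1 - t) ^ 2 * (1 - 2 * t) ^ (2 * m)))
      = (2 * (m : ℝ) + 2) / (2 * m + 3) := by
  have h0 : 2 * (m : ℝ) + 3 ≠ 0 := by positivity
  have hd : ∀ t ∈ Set.uIcc (0 : ℝ) 1, HasDerivAt (fun t : ℝ => -(1 / 2) *
      ((1 - 2 * t) ^ (2 * m + 2) + (1 / 2) * (1 - 2 * t) ^ (2 * m + 1)
        + ((2 * m + 1) / (2 * (2 * m + 3))) * (1 - 2 * t) ^ (2 * m + 3)))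
      ((1 - 2 * t) ^ (2 * m + 1)
        + (4 * m + 2) * ((1 - t) ^ 2 * (1 - 2 * t) ^ (2 * m))) t := by
    intro t _
    have hu : HasDerivAt (fun t : ℝ => 1 - 2 * t) (-2) t := by
      simpa using ((hasDerivAt_id t).const_mul 2).const_sub 1
    convert! (((hu.pow (2 * m + 2)).add ((hu.pow (2 * m + 1)).const_mul (1 / 2))).add
      ((hu.pow (2 * m + 3)).const_mul ((2 * (m : ℝ) + 1) / (2 * (2 * m + 3))))).const_mul (-(1 / 2))
      using 1
    simp only [Nat.add_sub_cancel, show 2 * m + 2 - 1 = 2 * m + 1 by omega,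
      show 2 * m + 3 - 1 = 2 * m + 2 by omega]
    push_cast
    field_simp
    ring
  rw [integral_eq_sub_of_hasDerivAt hd (Continuous.intervalIntegrable (by fun_prop) _ _)]
  have e1 : (-1 : ℝ) ^ (2 * m) = 1 := by simp
  norm_num [pow_add, e1]
  field_simp
  ring

end Integral

section Main
variable [Fintype α] [DecidableEq α] {D : Perm α}

lemma sum_restrictSign_factorial (hD : ∀ x, D (D x) = x) {W : Finset α} {r : ℕ}
    (hW : ∀ w ∈ W, D w ∈ W) (hr : #{w ∈ W | D w ≠ w} = 2 * r)
    (hcard : #W + 2 ≤ Fintype.card α) :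
    ((∑ B ∈ W.powerset,
        restrictSign D B * ((#B).factorial * (Fintype.card α - 2 - #B).factorial : ℕ) : ℤ) : ℝ)
      = (Fintype.card α - 1).factorial *
        ∫ t in (0 : ℝ)..1, (1 - t) ^ (Fintype.card α - 2 - #W) * (1 - 2 * t) ^ r := by
  have h1 : ∀ t : ℝ, (1 - t) ^ (Fintype.card α - 2 - #W) * (1 - 2 * t) ^ r
      = ∑ B ∈ W.powerset,
        (restrictSign D B : ℝ) * (t ^ #B * (1 - t) ^ (Fintype.card α - 2 - #B)) := by
    intro t
    have h := sum_powerset_restrictSign hD (p := t) (q := 1 - t) (by ring) W r hW hr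
    rw [show 1 - 2 * t = 1 - t - t by ring, ← h, mul_sum]
    refine sum_congr rfl fun B hB => ?_
    have hB' := card_le_card (mem_powerset.1 hB)
    rw [show Fintype.card α - 2 - #B = (Fintype.card α - 2 - #W) + (#W - #B) by omega, pow_add]
    ring
  simp only [h1]
  rw [intervalIntegral.integral_finsetSum
    fun B _ => Continuous.intervalIntegrable (by fun_prop) _ _, mul_sum]
  push_cast
  refine sum_congr rfl fun B hB => ?_
  have hB' := card_le_card (mem_powerset.1 hB)
  have h2 := integral_pow_mul_one_sub_pow (Fintype.card α - 2 - #B) #B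
  rw [show #B + (Fintype.card α - 2 - #B) + 1 = Fintype.card α - 1 by omega] at h2
  rw [intervalIntegral.integral_const_mul, ← h2]
  ring

open Classical in
/-- The number of ways to write an involution with `b` transpositions, `b` even, as a product of
two full cycles. -/
lemma card_isFull_mul_of_involution [Nonempty α] (hD : ∀ x, D (D x) = x) {b : ℕ}
    (hb : #D.support = 2 * b) (hev : Even b) :
    (b + 1) * #{u : Perm α | IsFull u ∧ IsFull (D * u)} = (Fintype.card α - 1).factorial := by
  obtain ⟨m, rfl⟩ | rfl : (∃ m, b = 2 * m + 2) ∨ b = 0 := by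
    obtain ⟨c, hc⟩ := hev
    rcases c with _ | c
    · right; omega
    · left; exact ⟨c, by omega⟩
  swap
  · have : D = 1 := by simpa using hb
    subst this
    simp [card_isFull]
  obtain ⟨z, hz⟩ : D.support.Nonempty := card_pos.1 (by omega)
  rw [mem_support] at hz
  have hn : 2 * (2 * m + 2) ≤ Fintype.card α := hb ▸ card_le_univ _
  set n := Fintype.card α with hndef
  have hWst : ∀ x, ∀ w ∈ ({x, D x, z, D z} : Finset α)ᶜ, D w ∈ ({x, D x, z, D z} : Finset α)ᶜ := by
    intro x w hw
    simp only [mem_compl, mem_insert, mem_singleton, not_or] at hw ⊢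
    refine ⟨fun h => hw.2.1 ?_, fun h => hw.1 (D.injective h), fun h => hw.2.2.2 ?_,
      fun h => hw.2.2.1 (D.injective h)⟩
    · rw [← h, hD]
    · rw [← h, hD]
  have hWf : ∀ x, D x ≠ x → #{w ∈ ({x, D x, z, D z} : Finset α)ᶜ | D w ≠ w}
      = 2 * (2 * m + 2) - #({x, D x, z, D z} : Finset α) := by
    intro x hx
    rw [← hb, ← card_sdiff_of_subset]
    · congr 1
      ext w
      simp only [mem_filter, mem_compl, mem_sdiff, mem_support]
      tauto
    · intro w hw
      simp only [mem_insert, mem_singleton] at hw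
      rw [mem_support]
      rcases hw with rfl | rfl | rfl | rfl
      · exact hx
      · exact fun h => hx (D.injective h)
      · exact hz
      · exact fun h => hz (D.injective h)
  have hc2 : #({D z, D (D z), z, D z} : Finset α) = 2 := by
    rw [hD, show ({D z, z, z, D z} : Finset α) = {D z, z} by ext; simp; tauto, card_pair hz]
  have hc4 : ∀ x, x ≠ z → x ≠ D z → D x ≠ x → #({x, D x, z, D z} : Finset α) = 4 := by
    intro x h1 h2 h3
    have h4 : D x ≠ z := fun h => h2 (by rw [← h, hD])
    have h5 : D x ≠ D z := fun h => h1 (D.injective h)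
    rw [card_insert_of_notMem, card_insert_of_notMem, card_pair (Ne.symm hz)]
    · simp [h4, h5]
    · simp [h1, h2, h3.symm]
  set S : α → ℤ := fun x => ∑ B ∈ ({x, D x, z, D z} : Finset α)ᶜ.powerset,
    restrictSign D B * ((#B).factorial * (n - 2 - #B).factorial : ℕ) with hS
  set I₁ : ℝ := ∫ t in (0 : ℝ)..1, (1 - 2 * t) ^ (2 * m + 1) with hI₁
  set I₂ : ℝ := ∫ t in (0 : ℝ)..1, (1 - t) ^ 2 * (1 - 2 * t) ^ (2 * m) with hI₂
  have hS1 : (S (D z) : ℝ) = (n - 1).factorial * I₁ := by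
    simp only [hS]
    rw [sum_restrictSign_factorial hD (hWst _) (r := 2 * m + 1)]
    · rw [card_compl, hc2, show Fintype.card α - 2 - (Fintype.card α - 2) = 0 by omega]
      simp [hI₁, hndef]
    · rw [hWf _ (fun h => hz (D.injective h)), hc2]; omega
    · rw [card_compl, hc2]; omega
  have hS2 : ∀ x, x ≠ z → x ≠ D z → D x ≠ x → (S x : ℝ) = (n - 1).factorial * I₂ := by
    intro x h1 h2 h3
    simp only [hS]
    rw [sum_restrictSign_factorial hD (hWst _) (r := 2 * m)]
    · rw [card_compl, hc4 x h1 h2 h3,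
        show Fintype.card α - 2 - (Fintype.card α - 4) = 2 by omega]
    · rw [hWf _ h3, hc4 x h1 h2 h3]; omega
    · rw [card_compl, hc4 x h1 h2 h3]; omega
  have hidx : (univ.filter fun x => x ≠ z ∧ D x ≠ x)
      = insert (D z) ((D.support.erase z).erase (D z)) := by
    ext x
    simp only [mem_filter, mem_univ, true_and, mem_insert, mem_erase, mem_support]
    constructor
    · tauto
    · rintro (rfl | h)
      · exact ⟨hz, fun h => hz (D.injective h)⟩
      · exact h.2
  have hcount : #((D.support.erase z).erase (D z)) = 4 * m + 2 := by
    rw [card_erase_of_mem, card_erase_of_mem, hb]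
    · omega
    · rwa [mem_support]
    · rw [mem_erase, mem_support]; exact ⟨hz, fun h => hz (D.injective h)⟩
  have hsum : (((∑ x with x ≠ z ∧ D x ≠ x, S x : ℤ)) : ℝ)
      = (n - 1).factorial * ((2 * (m : ℝ) + 2) / (2 * m + 3)) := by
    rw [hidx, sum_insert (notMem_erase _ _)]
    push_cast
    rw [hS1, sum_congr rfl fun x hx => hS2 x ?_ ?_ ?_, sum_const, hcount, ← integral_final m,
      intervalIntegral.integral_add (Continuous.intervalIntegrable (by fun_prop) _ _)
        (Continuous.intervalIntegrable (by fun_prop) _ _), intervalIntegral.integral_const_mul]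
    · rw [nsmul_eq_mul]
      push_cast
      ring
    all_goals
      simp only [mem_erase, mem_support] at hx
      tauto
  have hmain : (#{u : Perm α | IsFull u ∧ IsFull (D * u)} : ℝ)
      = (n - 1).factorial - (((∑ x with x ≠ z ∧ D x ≠ x, S x : ℤ)) : ℝ) := by
    exact_mod_cast card_isFull_mul hD z
  rw [hsum] at hmain
  have h0 : 2 * (m : ℝ) + 3 ≠ 0 := by positivity
  have : (((2 * m + 2 : ℕ) + 1 : ℝ)) * #{u : Perm α | IsFull u ∧ IsFull (D * u)}
      = (n - 1).factorial := by
    rw [hmain]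
    push_cast
    field_simp
    ring
  exact_mod_cast this

end Main
end FullCycle

/-- For a permutation `D` of `[n]` of cycle type `1^{a₁} 2^{a₂}` (so `D` has
`a₁` fixed points and `a₂` transpositions, `a₁ + 2a₂ = n`), with
`n - a₁ - a₂` even, the number of ordered pairs `(s, t)` of `n`-cycles with
`D = s * t` equals `(n-1)! / (n + 1 - a₁ - a₂)`, stated multiplicatively.
An `n`-cycle is a permutation conjugate to `finRotate n`. -/
theorem factorizations_into_two_n_cycles_of_type_1a2b
    (n a₁ a₂ : ℕ) (hn : 0 < n) (D : Equiv.Perm (Fin n))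
    (hD : D.cycleType = Multiset.replicate a₂ 2)
    (ha : a₁ + 2 * a₂ = n)
    (hpar : Even (n - (a₁ + a₂))) :
    (n + 1 - (a₁ + a₂)) *
      {p : Equiv.Perm (Fin n) × Equiv.Perm (Fin n) |
          IsConj (finRotate n) p.1 ∧ IsConj (finRotate n) p.2 ∧
            p.1 * p.2 = D}.ncard
      = Nat.factorial (n - 1) := by
  classical
  have : Nonempty (Fin n) := ⟨⟨0, hn⟩⟩
  have hsupp : D.support.card = 2 * a₂ := by
    rw [← Equiv.Perm.sum_cycleType, hD]; simp [mul_comm]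
  have hsq : D ^ 2 = 1 := by
    rw [← orderOf_dvd_iff_pow_eq_one, ← Equiv.Perm.lcm_cycleType, hD, Multiset.lcm_dvd]
    intro b hb
    rw [Multiset.eq_of_mem_replicate hb]
  have hinv : ∀ x, D (D x) = x := fun x => by
    rw [← Equiv.Perm.mul_apply, ← sq, hsq, Equiv.Perm.one_apply]
  rw [show n + 1 - (a₁ + a₂) = a₂ + 1 by omega]
  have key := FullCycle.card_isFull_mul_of_involution hinv hsupp
    (by rwa [show n - (a₁ + a₂) = a₂ by omega] at hpar)
  rw [Fintype.card_fin] at key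
  rw [← key, ← Set.ncard_coe_finset]
  congr 1
  simp only [← FullCycle.isFull_iff_isConj hn]
  refine Set.ncard_congr (fun p _ => p.2⁻¹) ?_ ?_ ?_
  · rintro ⟨s, t⟩ ⟨hs, ht, rfl⟩
    simpa using ⟨ht.inv, hs⟩
  · rintro ⟨s, t⟩ ⟨s', t'⟩ ⟨_, _, h⟩ ⟨_, _, h'⟩ htt
    have htt' : t = t' := inv_injective htt
    subst htt'
    have : s = s' := mul_right_cancel (h.trans h'.symm)
    rw [this]
  · intro u hu
    simp only [Finset.coe_filter, Finset.mem_univ, true_and, Set.mem_ofPred_eq] at hu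
    exact ⟨(D * u, u⁻¹), ⟨hu.2, hu.1.inv, by simp⟩, by simp⟩
end
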